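/- Every connected subcubic graph G on n vertices that has no open twins, has no isolated vertices, and is not isomorphic to K_3 or K_4, satisfies γ^LD(G) ≤ n/2 (closed twins of any degree are allowed). -/

import Mathlib

open SimpleGraph

/-- The closed neighbourhood `N[v] = N(v) ∪ {v}` of a vertex. -/
def closedNbhd {V : Type*} (G : SimpleGraph V) (v : V) : Set V :=
  insert v (G.neighborSet v)

/-- The degree of a vertex, as the cardinality of its open neighbourhood. -/
noncomputable def deg {V : Type*} (G : SimpleGraph V) (v : V) : ℕ :=
  (G.neighborSet v).ncard

/-- `S` is a dominating set: every vertex has a member of `S` in its closed neighbourhood. -/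
def IsDominating {V : Type*} (G : SimpleGraph V) (S : Set V) : Prop :=
  ∀ v : V, (closedNbhd G v ∩ S).Nonempty

/-- `S` is a locating-dominating set: it dominates and separates all pairs of
vertices outside `S` by their closed neighbourhoods intersected with `S`. -/
def IsLDSet {V : Type*} (G : SimpleGraph V) (S : Set V) : Prop :=
  IsDominating G S ∧
    ∀ u ∉ S, ∀ v ∉ S, u ≠ v → closedNbhd G u ∩ S ≠ closedNbhd G v ∩ S

/-- The location-domination number `γ^LD(G)`. -/
noncomputable def ldNum {V : Type*} (G : SimpleGraph V) : ℕ :=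
  sInf {k : ℕ | ∃ S : Set V, IsLDSet G S ∧ S.ncard = k}

/-- A graph is subcubic if every vertex has degree at most 3. -/
def Subcubic {V : Type*} (G : SimpleGraph V) : Prop :=
  ∀ v : V, deg G v ≤ 3

/-- `u` and `v` are open twins: distinct vertices with the same open neighbourhood. -/
def OpenTwins {V : Type*} (G : SimpleGraph V) (u v : V) : Prop :=
  u ≠ v ∧ G.neighborSet u = G.neighborSet v

/-- `u` and `v` are closed twins: distinct vertices with the same closed neighbourhood. -/
def ClosedTwins {V : Type*} (G : SimpleGraph V) (u v : V) : Prop :=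
  u ≠ v ∧ closedNbhd G u = closedNbhd G v

/-- A graph is twin-free if it has neither open twins nor closed twins. -/
def TwinFree {V : Type*} (G : SimpleGraph V) : Prop :=
  (¬ ∃ u v : V, OpenTwins G u v) ∧ (¬ ∃ u v : V, ClosedTwins G u v)

namespace LocatingColouring

variable {V : Type*} {G : SimpleGraph V} {U : Set V} {c : V → Bool}

/-- Remove all edges of `G` that meet `U`. -/
def removeEdgesAt (G : SimpleGraph V) (U : Set V) : SimpleGraph V where
  Adj a b := G.Adj a b ∧ a ∉ U ∧ b ∉ U
  symm := ⟨fun _ _ h => ⟨h.1.symm, h.2.2, h.2.1⟩⟩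
  loopless := ⟨fun a h => G.loopless.irrefl a h.1⟩

theorem removeEdgesAt_adj {a b : V} :
    (removeEdgesAt G U).Adj a b ↔ G.Adj a b ∧ a ∉ U ∧ b ∉ U := Iff.rfl

theorem removeEdgesAt_lt {a b : V} (ha : a ∈ U) (hab : G.Adj a b) : removeEdgesAt G U < G :=
  lt_of_le_not_ge (fun _ _ h => h.1) fun h => (h hab).2.1 ha

/-- A two-colouring in which every non-isolated vertex has a neighbour of the other colour, and
any two vertices of the same colour with different neighbourhoods already differ on the
neighbours of the other colour. -/
structure Good (G : SimpleGraph V) (c : V → Bool) : Prop where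
  dom : ∀ u w, G.Adj u w → ∃ w, G.Adj u w ∧ c w ≠ c u
  sep : ∀ u v, c u = c v → (∀ w, c w ≠ c u → (G.Adj u w ↔ G.Adj v w)) →
    ∀ w, G.Adj u w ↔ G.Adj v w

/-- The vertices `p`, `q`, `r` form a connected component isomorphic to a triangle. -/
structure IsTriangleComponent (G : SimpleGraph V) (p q r : V) : Prop where
  pq : G.Adj p q
  qr : G.Adj q r
  pr : G.Adj p r
  left : ∀ w, G.Adj p w → w = q ∨ w = r
  mid : ∀ w, G.Adj q w → w = p ∨ w = r
  right : ∀ w, G.Adj r w → w = p ∨ w = q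

/-- A subcubic graph without a `K₄` and without a triangle component that has no good colouring
and is minimal with respect to deleting edges. -/
structure MinimalBad (G : SimpleGraph V) : Prop where
  subcubic : ∀ z a b d e, G.Adj z a → G.Adj z b → G.Adj z d → G.Adj z e →
    a = b ∨ a = d ∨ a = e ∨ b = d ∨ b = e ∨ d = e
  noK4 : ∀ a b d e, G.Adj a b → G.Adj a d → G.Adj a e → G.Adj b d → G.Adj b e → ¬ G.Adj d e
  noTriangle : ∀ p q r, ¬ IsTriangleComponent G p q r
  bad : ∀ c, ¬ Good G c
  minimal : ∀ H < G, (∀ p q r, ¬ IsTriangleComponent H p q r) → ∃ c, Good H c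

theorem Good.congr {c' : V → Bool} (hc : Good G c) (h : ∀ v w, G.Adj v w → c' v = c v) :
    Good G c' := by
  have hdom : ∀ u w, G.Adj u w → ∃ w, G.Adj u w ∧ c' w ≠ c' u := by
    intro u w huw
    obtain ⟨x, hx, hxc⟩ := hc.dom u w huw
    exact ⟨x, hx, by rwa [h x u hx.symm, h u w huw]⟩
  refine ⟨hdom, fun u v huv hs w => ?_⟩
  by_cases hu : ∃ x, G.Adj u x
  · obtain ⟨x, hx⟩ := hu
    obtain ⟨y, hy, hyc⟩ := hdom u x hx
    have hv := (hs y hyc).1 hy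
    refine hc.sep u v (by rw [← h u x hx, ← h v y hv, huv]) (fun w hw => ?_) w
    by_cases hw' : ∃ z, G.Adj w z
    · obtain ⟨z, hz⟩ := hw'
      exact hs w (by rwa [h w z hz, h u x hx])
    · exact iff_of_false (fun h => hw' ⟨u, h.symm⟩) (fun h => hw' ⟨v, h.symm⟩)
  · by_cases hv : ∃ x, G.Adj v x
    · obtain ⟨x, hx⟩ := hv
      obtain ⟨y, hy, hyc⟩ := hdom v x hx
      exact absurd ⟨y, (hs y (huv ▸ hyc)).2 hy⟩ hu
    · push Not at hu hv
      simp [hu, hv]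

theorem Good.recolour {c' : V → Bool} (hc : Good (removeEdgesAt G U) c)
    (h : ∀ v, v ∉ U → c' v = c v) : Good (removeEdgesAt G U) c' :=
  hc.congr fun v _ hv => h v hv.2.1

theorem Good.extend (hc : Good (removeEdgesAt G U) c)
    (h₁ : ∀ u ∈ U, ∀ w, G.Adj u w → ∃ w, G.Adj u w ∧ c w ≠ c u)
    (h₂ : ∀ u ∉ U, ∀ w, G.Adj u w → (∀ w, G.Adj u w → w ∈ U) → ∃ w, G.Adj u w ∧ c w ≠ c u)
    (h₃ : ∀ u ∉ U, ∀ v ∉ U, c u = c v → (∀ w ∉ U, G.Adj u w ↔ G.Adj v w) →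
      ∀ d ∈ U, G.Adj u d → ¬ G.Adj v d → ∃ w ∈ U, ¬ (G.Adj u w ↔ G.Adj v w) ∧ c w ≠ c u)
    (h₄ : ∀ u ∈ U, ∀ v, v ≠ u → c v = c u → (∀ w, c w ≠ c u → (G.Adj u w ↔ G.Adj v w)) →
      ∀ x, G.Adj u x → c x ≠ c u → ∀ w, G.Adj u w ↔ G.Adj v w) : Good G c := by
  have hdom : ∀ u w, G.Adj u w → ∃ w, G.Adj u w ∧ c w ≠ c u := by
    intro u w huw
    by_cases hu : u ∈ U
    · exact h₁ u hu w huw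
    by_cases hU : ∀ w, G.Adj u w → w ∈ U
    · exact h₂ u hu w huw hU
    push Not at hU
    obtain ⟨x, hx, hxU⟩ := hU
    obtain ⟨y, hy, hyc⟩ := hc.dom u x ⟨hx, hu, hxU⟩
    exact ⟨y, hy.1, hyc⟩
  have hU : ∀ u ∈ U, ∀ v, c v = c u → (∀ w, c w ≠ c u → (G.Adj u w ↔ G.Adj v w)) →
      ∀ w, G.Adj u w ↔ G.Adj v w := by
    intro u hu v hv hs
    by_cases hn : ∃ x, G.Adj u x
    · obtain ⟨x, hx⟩ := hn
      obtain ⟨y, hy, hyc⟩ := hdom u x hx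
      by_cases hvu : v = u
      · simp [hvu]
      · exact h₄ u hu v hvu hv hs y hy hyc
    · intro w
      by_cases hvw : G.Adj v w
      · obtain ⟨y, hy, hyc⟩ := hdom v w hvw
        exact absurd ⟨y, (hs y (hv ▸ hyc)).2 hy⟩ hn
      · push Not at hn
        simp [hn, hvw]
  refine ⟨hdom, fun u v huv hs => ?_⟩
  by_cases hu : u ∈ U
  · exact hU u hu v huv.symm hs
  by_cases hv : v ∈ U
  · exact fun w => (hU v hv u huv (fun w hw => (hs w (huv ▸ hw)).symm) w).symm
  have hW : ∀ w ∉ U, G.Adj u w ↔ G.Adj v w := by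
    intro w hw
    have := hc.sep u v huv (fun x hx => by
      simp only [removeEdgesAt_adj, hs x hx, hu, hv]) w
    simpa [removeEdgesAt_adj, hu, hv, hw] using this
  intro w
  by_cases hw : w ∈ U
  · by_contra hne
    by_cases hvw : G.Adj v w
    · obtain ⟨y, -, hy, hyc⟩ := h₃ v hv u hu huv.symm (fun w hw => (hW w hw).symm) w hw hvw
        (fun h => hne (by simp [h, hvw]))
      exact hy (hs y (huv ▸ hyc)).symm
    · obtain ⟨y, -, hy, hyc⟩ := h₃ u hu v hv huv hW w hw (by tauto) hvw
      exact hy (hs y hyc)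
  · exact hW w hw

/-- Either a good colouring survives away from `U`, or a triangle component is split off. -/
theorem MinimalBad.exists_good (hG : MinimalBad G) {a b : V} (ha : a ∈ U) (hab : G.Adj a b)
    (hT : ∀ p q r, ¬ IsTriangleComponent (removeEdgesAt G U) p q r) :
    ∃ c, Good (removeEdgesAt G U) c :=
  hG.minimal _ (removeEdgesAt_lt ha hab) hT

theorem MinimalBad.not_closed (hG : MinimalBad G) {a b : V} (ha : a ∈ U) (hab : G.Adj a b)
    (hU : ∀ u ∈ U, ∀ w, G.Adj u w → w ∈ U) (c : V → Bool)
    (hdom : ∀ u ∈ U, ∃ w, G.Adj u w ∧ c w ≠ c u)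
    (hsep : ∀ u ∈ U, ∀ v ∈ U, v ≠ u → c v = c u →
      (∀ w, c w ≠ c u → (G.Adj u w ↔ G.Adj v w)) → ∀ w, G.Adj u w ↔ G.Adj v w) : False := by
  classical
  have hmem : ∀ p q, (removeEdgesAt G U).Adj p q → ∀ w, G.Adj p w →
      (removeEdgesAt G U).Adj p w := fun p q hpq w hw =>
    ⟨hw, hpq.2.1, fun hwU => hpq.2.1 (hU w hwU p hw.symm)⟩
  obtain ⟨d, hd⟩ := hG.exists_good ha hab fun p q r h => hG.noTriangle p q r
    ⟨h.pq.1, h.qr.1, h.pr.1, fun w hw => h.left w (hmem p q h.pq w hw),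
      fun w hw => h.mid w (hmem q r h.qr w hw), fun w hw => h.right w (hmem r p h.pr.symm w hw)⟩
  refine hG.bad (fun v => if v ∈ U then c v else d v)
    (Good.extend (U := U) (hd.recolour (by simp +contextual)) ?_ ?_ ?_ ?_)
  · intro u hu _ _
    obtain ⟨w, hw, hwc⟩ := hdom u hu
    exact ⟨w, hw, by simpa [hu, hU u hu w hw]⟩
  · exact fun u hu w huw h => absurd (hU w (h w huw) u huw.symm) hu
  · exact fun u hu v _ _ _ d hd hud => absurd (hU d hd u hud.symm) hu
  · intro u hu v hvu hcol hs x hx hxc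
    have hxU := hU u hu x hx
    have hvU := hU x hxU v ((hs x hxc).1 hx).symm
    refine hsep u hu v hvU hvu (by simpa [hu, hvU] using hcol) fun w hw => ?_
    by_cases hwU : w ∈ U
    · exact hs w (by simpa [hu, hwU])
    · exact iff_of_false (fun h => hwU (hU u hu w h)) (fun h => hwU (hU v hvU w h))

theorem MinimalBad.not_closed_proper (hG : MinimalBad G) {a b : V} (ha : a ∈ U)
    (hab : G.Adj a b) (hU : ∀ u ∈ U, ∀ w, G.Adj u w → w ∈ U) (hne : ∀ u ∈ U, ∃ w, G.Adj u w)
    (c : V → Bool) (hc : ∀ u ∈ U, ∀ w, G.Adj u w → c w ≠ c u) : False := by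
  refine hG.not_closed ha hab hU c (fun u hu => ?_) (fun u hu v hv _ hcol hs w => ?_)
  · obtain ⟨w, hw⟩ := hne u hu
    exact ⟨w, hw, hc u hu w hw⟩
  · refine ⟨fun h => (hs w (hc u hu w h)).1 h, fun h => (hs w ?_).2 h⟩
    rw [← hcol]
    exact hc v hv w h

/-- The triangle `p`, `q`, `r` becomes a component after isolating `U`, and `p` has a neighbour
`x` in `U`. -/
structure IsAttachedTriangle (G : SimpleGraph V) (U : Set V) (p q r x : V) : Prop where
  pq : G.Adj p q
  qr : G.Adj q r
  pr : G.Adj p r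
  px : G.Adj p x
  hp : p ∉ U
  hq : q ∉ U
  hr : r ∉ U
  hx : x ∈ U
  left : ∀ w, G.Adj p w ↔ w = q ∨ w = r ∨ w = x
  mid : ∀ w, G.Adj q w → w = p ∨ w = r ∨ w ∈ U
  right : ∀ w, G.Adj r w → w = p ∨ w = q ∨ w ∈ U

theorem MinimalBad.exists_good_of_not_attached (hG : MinimalBad G) {a b : V} (ha : a ∈ U)
    (hab : G.Adj a b) (hT : ∀ p q r x, ¬ IsAttachedTriangle G U p q r x) :
    ∃ c, Good (removeEdgesAt G U) c := by
  refine hG.exists_good ha hab fun p q r h => ?_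
  have key : ∀ p q r x, IsTriangleComponent (removeEdgesAt G U) p q r → x ∈ U →
      ¬ G.Adj p x := by
    intro p q r x h hx hpx
    have hp := h.pq.2.1
    have hq := h.pq.2.2
    have hr := h.pr.2.2
    refine hT p q r x ⟨h.pq.1, h.qr.1, h.pr.1, hpx, hp, hq, hr, hx, fun w => ⟨fun hw => ?_, ?_⟩,
      fun w hw => ?_, fun w hw => ?_⟩
    · have := hG.subcubic p q r x w h.pq.1 h.pr.1 hpx hw
      have := h.qr.1.ne
      grind
    · rintro (rfl | rfl | rfl)
      exacts [h.pq.1, h.pr.1, hpx]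
    · by_cases hwU : w ∈ U
      · exact .inr (.inr hwU)
      · rcases h.mid w ⟨hw, hq, hwU⟩ with h | h <;> simp [h]
    · by_cases hwU : w ∈ U
      · exact .inr (.inr hwU)
      · rcases h.right w ⟨hw, hr, hwU⟩ with h | h <;> simp [h]
  have h₂ : IsTriangleComponent (removeEdgesAt G U) q p r :=
    ⟨h.pq.symm, h.pr, h.qr, h.mid, h.left, fun w hw => (h.right w hw).symm⟩
  have h₃ : IsTriangleComponent (removeEdgesAt G U) r p q :=
    ⟨h.pr.symm, h.pq, h.qr.symm, h.right, fun w hw => (h.left w hw).symm,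
      fun w hw => (h.mid w hw).symm⟩
  refine hG.noTriangle p q r ⟨h.pq.1, h.qr.1, h.pr.1, fun w hw => ?_, fun w hw => ?_,
    fun w hw => ?_⟩
  · exact h.left w ⟨hw, h.pq.2.1, fun hwU => key p q r w h hwU hw⟩
  · exact h.mid w ⟨hw, h.pq.2.2, fun hwU => key q p r w h₂ hwU hw⟩
  · exact h.right w ⟨hw, h.pr.2.2, fun hwU => key r p q w h₃ hwU hw⟩

/-- A minimal bad graph has no non-isolated open twins. -/
theorem MinimalBad.no_twins (hG : MinimalBad G) {y u w₀ : V} (hne : y ≠ u) (hw₀ : G.Adj y w₀)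
    (h : ∀ w, G.Adj y w ↔ G.Adj u w) : False := by
  classical
  have hirr : ∀ a b, G.Adj a b → a ≠ b := fun a b h => h.ne
  have hsym : ∀ a b, G.Adj a b → G.Adj b a := fun a b h => h.symm
  have hyu : ¬ G.Adj y u := fun hyu => (h u).1 hyu |>.ne rfl
  by_cases hT : ∃ p q r x, IsAttachedTriangle G {y} p q r x
  · obtain ⟨p, q, r, x, h'⟩ := hT
    obtain rfl : x = y := h'.hx
    have hu : u = q ∨ u = r := by
      have := (h p).1 h'.px.symm
      have := (h'.left u).1 this.symm
      grind
    have := h'.qr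
    have := h'.pq
    have := h'.pr
    have := h'.px
    have := h'.left
    have := h'.mid
    have := h'.right
    rcases hu with rfl | rfl
    · refine hG.not_closed (U := {x, u, p, r}) (a := x) (b := p) (by simp) (by grind) ?_
        (fun v => if v = p ∨ v = x then false else true) ?_ ?_ <;> simp <;> grind
    · refine hG.not_closed (U := {x, u, p, q}) (a := x) (b := p) (by simp) (by grind) ?_
        (fun v => if v = p ∨ v = x then false else true) ?_ ?_ <;> simp <;> grind
  push Not at hT
  obtain ⟨d, hd⟩ := hG.exists_good_of_not_attached (U := {y}) rfl hw₀ hT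
  obtain ⟨c, hc, hcy⟩ : ∃ c : V → Bool, (∀ v, v ∉ ({y} : Set V) → c v = d v) ∧ c y = d u :=
    ⟨fun v => if v = y then d u else d v, by simp +contextual, by simp⟩
  have hgood := hd.recolour hc
  have hdom := hgood.dom
  have hsep := hgood.sep u
  simp only [removeEdgesAt_adj, Set.mem_singleton_iff] at hdom hsep hc
  have hcu := hc u hne.symm
  refine hG.bad c (hgood.extend ?_ ?_ ?_ ?_)
  all_goals simp only [Set.mem_singleton_iff, forall_eq, exists_eq_left]
  · grind
  · grind
  · grind
  · intro v hvy hcv hs x hx hxc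
    have := hsep v (by grind) (by grind)
    grind

theorem MinimalBad.exists_third (hG : MinimalBad G) {z a b : V} (ha : G.Adj z a) (hb : G.Adj z b)
    (hab : a ≠ b) : ∃ d, ∀ w, G.Adj z w ↔ w = a ∨ w = b ∨ w = d := by
  by_cases h : ∃ d, G.Adj z d ∧ d ≠ a ∧ d ≠ b
  · obtain ⟨d, hd, hda, hdb⟩ := h
    refine ⟨d, fun w => ⟨fun hw => ?_, ?_⟩⟩
    · have := hG.subcubic z a b d w ha hb hd hw
      grind
    · rintro (rfl | rfl | rfl) <;> assumption
  · exact ⟨a, by grind⟩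

theorem MinimalBad.no_pendant_triangle (hG : MinimalBad G) {s p p' : V} (hsp : G.Adj s p)
    (hsp' : G.Adj s p') (hpp' : G.Adj p p') (hp₀ : ∀ w, G.Adj p w → w = s ∨ w = p')
    (hp₁ : ∀ w, G.Adj p' w → w = s ∨ w = p) : False := by
  classical
  have hirr : ∀ a b, G.Adj a b → a ≠ b := fun a b h => h.ne
  have hsym : ∀ a b, G.Adj a b → G.Adj b a := fun a b h => h.symm
  obtain ⟨w, hw⟩ := hG.exists_third hsp hsp' hpp'.ne
  by_cases hwp : w = p ∨ w = p'
  · exact hG.noTriangle s p p' ⟨hsp, hpp', hsp', by grind, hp₀, hp₁⟩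
  by_cases hT : ∃ a b d x, IsAttachedTriangle G {s, p, p'} a b d x
  · obtain ⟨a, q, r, x, h⟩ := hT
    obtain ⟨hpq, hqr, hpr, hpx, h1, h2, h3, hx, hl, hm, hr'⟩ := h
    simp only [Set.mem_insert_iff, Set.mem_singleton_iff] at *
    have hxs : x = s := by grind
    have haw : a = w := by grind
    subst hxs haw
    have := hpp'.ne
    have hq : ∀ w, G.Adj q w ↔ w = a ∨ w = r := by grind
    have hr : ∀ w, G.Adj r w ↔ w = a ∨ w = q := by grind
    have hp : ∀ w, G.Adj p w ↔ w = x ∨ w = p' := by grind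
    have hp' : ∀ w, G.Adj p' w ↔ w = x ∨ w = p := by grind
    obtain ⟨c, hca, hcq, hcp, hcr, hcx, hcp'⟩ : ∃ c : V → Bool, c a = false ∧ c q = false ∧
        c p = false ∧ c r = true ∧ c x = true ∧ c p' = true :=
      ⟨fun v => !(decide (v = a ∨ v = q ∨ v = p)), by grind⟩
    clear hr' hm hp₀ hp₁
    refine hG.not_closed (U := {x, p, p', a, q, r}) (a := x) (b := p) (by simp) hsp ?_ c ?_ ?_
    all_goals simp only [Set.mem_insert_iff, Set.mem_singleton_iff]
    · grind
    · rintro u (rfl | rfl | rfl | rfl | rfl | rfl)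
      exacts [⟨a, by grind⟩, ⟨x, by grind⟩, ⟨p, by grind⟩, ⟨x, by grind⟩, ⟨r, by grind⟩,
        ⟨q, by grind⟩]
    · rintro u (rfl | rfl | rfl | rfl | rfl | rfl) v (rfl | rfl | rfl | rfl | rfl | rfl) <;> grind
  push Not at hT
  obtain ⟨d, hd⟩ := hG.exists_good_of_not_attached (U := {s, p, p'}) (by simp) hsp hT
  obtain ⟨c, hc, hcs, hcp, hcp'⟩ : ∃ c : V → Bool, (∀ v, v ∉ ({s, p, p'} : Set V) → c v = d v) ∧
      c s = !d w ∧ c p = d w ∧ c p' = !d w :=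
    ⟨fun v => if v = s then !d w else if v = p then d w else if v = p' then !d w else d v,
      by simp +contextual, by grind, by grind, by grind⟩
  have hgood := hd.recolour hc
  have hdom := hgood.dom
  have hcw := hc w (by simp; grind [((hw w).2 (by simp)).ne])
  simp only [removeEdgesAt_adj, Set.mem_insert_iff, Set.mem_singleton_iff] at hdom
  refine hG.bad c (hgood.extend ?_ ?_ ?_ ?_)
  all_goals simp only [Set.mem_insert_iff, Set.mem_singleton_iff, forall_eq_or_imp, forall_eq]
  · grind
  · grind
  · grind
  · grind

theorem MinimalBad.no_triangle_pair (hG : MinimalBad G) {x z z' s s' g : V}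
    (hx : ∀ w, G.Adj x w ↔ w = z ∨ w = z') (hz : ∀ w, G.Adj z w ↔ w = x ∨ w = z' ∨ w = s)
    (hz' : ∀ w, G.Adj z' w ↔ w = x ∨ w = z ∨ w = s') (hg : ∀ w, G.Adj g w ↔ w = s ∨ w = s')
    (hs : ∀ w, G.Adj s w ↔ w = g ∨ w = s' ∨ w = z)
    (hs' : ∀ w, G.Adj s' w ↔ w = g ∨ w = s ∨ w = z')
    (h₁ : s ≠ x) (h₂ : s ≠ z') (h₃ : s' ≠ x) (h₄ : s' ≠ z) (h₅ : s ≠ s') (h₆ : g ≠ z)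
    (h₇ : g ≠ z') : False := by
  classical
  have n₁ := ((hx z).2 (by simp)).ne
  have n₂ := ((hx z').2 (by simp)).ne
  have n₃ := ((hz z').2 (by simp)).ne
  have n₄ := ((hz s).2 (by simp)).ne
  have n₅ := ((hz' s').2 (by simp)).ne
  have n₆ := ((hg s).2 (by simp)).ne
  have n₇ := ((hg s').2 (by simp)).ne
  have n₈ : g ≠ x := by
    rintro rfl
    have := hx z
    have := hg z
    grind
  obtain ⟨c, c₁, c₂, c₃, c₄, c₅, c₆⟩ : ∃ c : V → Bool, c x = false ∧ c s = false ∧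
      c g = false ∧ c z = true ∧ c z' = true ∧ c s' = true :=
    ⟨fun v => !(decide (v = x ∨ v = s ∨ v = g)), by grind⟩
  refine hG.not_closed (U := {x, z, z', s, s', g}) (a := x) (b := z) (by simp) (by grind) ?_ c ?_ ?_
  all_goals simp only [Set.mem_insert_iff, Set.mem_singleton_iff]
  · grind
  · rintro u (rfl | rfl | rfl | rfl | rfl | rfl)
    exacts [⟨z, by grind⟩, ⟨x, by grind⟩, ⟨x, by grind⟩, ⟨z, by grind⟩, ⟨s, by grind⟩,
      ⟨s', by grind⟩]
  · rintro u (rfl | rfl | rfl | rfl | rfl | rfl) v (rfl | rfl | rfl | rfl | rfl | rfl) <;> grind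

theorem MinimalBad.no_diamond (hG : MinimalBad G) {x z z' s : V}
    (hx : ∀ w, G.Adj x w ↔ w = z ∨ w = z') (hz : ∀ w, G.Adj z w ↔ w = x ∨ w = z' ∨ w = s)
    (hz' : ∀ w, G.Adj z' w ↔ w = x ∨ w = z ∨ w = s) (hsx : s ≠ x) : False := by
  classical
  have hirr : ∀ a b, G.Adj a b → a ≠ b := fun a b h => h.ne
  have hsym : ∀ a b, G.Adj a b → G.Adj b a := fun a b h => h.symm
  have e₁ : G.Adj x z := by grind
  have e₂ : G.Adj x z' := by grind
  have e₃ : G.Adj z z' := by grind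
  have e₄ : G.Adj z s := by grind
  have e₅ : G.Adj z' s := by grind
  have n₁ := e₁.ne
  have n₂ := e₂.ne
  have n₃ := e₃.ne
  have n₄ := e₄.ne
  have n₅ := e₅.ne
  have hmem : ∀ v, v ∈ ({x, z, z'} : Set V) ↔ v = x ∨ v = z ∨ v = z' := by simp
  have hex : ∃ t, G.Adj s t ∧ t ≠ z ∧ t ≠ z' := by
    by_contra
    exact hG.no_twins (w₀ := z) hsx (by grind) (by grind)
  obtain ⟨t, hst, htz, htz'⟩ := hex
  have hTn : ∀ p q r y, ¬ IsAttachedTriangle G {x, z, z'} p q r y := by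
    rintro p q r y ⟨hpq, hqr, hpr, hpx, h1, h2, h3, hx, hl, hm, hr⟩
    have := hqr.ne
    rw [hmem] at *
    obtain rfl : p = s := by grind
    have := hG.subcubic p q r z z'
    grind
  obtain ⟨d, hd⟩ := hG.exists_good_of_not_attached (by simp) ((hx z).2 (by simp)) hTn
  obtain ⟨c, hc, hcx, hcz, hcz'⟩ : ∃ c : V → Bool, (∀ v, v ∉ ({x, z, z'} : Set V) → c v = d v) ∧
      c x = !d s ∧ c z = !d s ∧ c z' = d s :=
    ⟨fun v => if v = x then !d s else if v = z then !d s else if v = z' then d s else d v,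
      by simp +contextual, by grind, by grind, by grind⟩
  clear hTn
  have hgood := hd.recolour hc
  have hdom := hgood.dom
  have hcw := hc s (by grind)
  simp only [removeEdgesAt_adj, Set.mem_insert_iff, Set.mem_singleton_iff] at hdom
  clear hc hd
  refine hG.bad c (hgood.extend ?_ ?_ ?_ ?_)
  all_goals simp only [Set.mem_insert_iff, Set.mem_singleton_iff, forall_eq_or_imp, forall_eq]
  · grind
  · grind
  · grind
  · grind

theorem MinimalBad.apex_aux (hG : MinimalBad G) {x z z' s s' : V} {d : V → Bool}
    (hU : ∀ v, v ∈ U ↔ v = x ∨ v = z ∨ v = z')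
    (hx : ∀ w, G.Adj x w ↔ w = z ∨ w = z') (hz : ∀ w, G.Adj z w ↔ w = x ∨ w = z' ∨ w = s)
    (hz' : ∀ w, G.Adj z' w ↔ w = x ∨ w = z ∨ w = s') (hsx : s ≠ x) (hsx' : s' ≠ x) (hsz : s ≠ z')
    (hsz' : s' ≠ z) (hss : s ≠ s') (hd : Good (removeEdgesAt G U) d)
    (hiso : d s ≠ d s' → ∃ t, G.Adj s' t ∧ t ≠ z')
    (hdem : d s ≠ d s' → ∀ v, d v = d s' → ¬ G.Adj v z' → ∃ w, w ≠ z' ∧ ¬ (G.Adj v w ↔ G.Adj s' w)) :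
    False := by
  classical
  have hirr : ∀ a b, G.Adj a b → a ≠ b := fun a b h => h.ne
  have hsym : ∀ a b, G.Adj a b → G.Adj b a := fun a b h => h.symm
  have e₁ : G.Adj x z := by grind
  have e₂ : G.Adj x z' := by grind
  have e₃ : G.Adj z z' := by grind
  have e₄ : G.Adj z s := by grind
  have e₅ : G.Adj z' s' := by grind
  have n₁ := e₁.ne
  have n₂ := e₂.ne
  have n₃ := e₃.ne
  have n₄ := e₄.ne
  have n₅ := e₅.ne
  obtain ⟨c, hc, hcx, hcz, hcz'⟩ : ∃ c : V → Bool, (∀ v, v ∉ U → c v = d v) ∧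
      c x = d s ∧ c z = !d s ∧ c z' = !d s :=
    ⟨fun v => if v = x then d s else if v = z then !d s else if v = z' then !d s else d v,
      by grind, by grind, by grind, by grind⟩
  have hgood := hd.recolour hc
  have hdom := hgood.dom
  have hcs := hc s (by grind)
  have hcs' := hc s' (by grind)
  simp only [removeEdgesAt_adj, hU] at hdom
  have hdem' : c s ≠ c s' → ∀ v, v ≠ x → v ≠ z → v ≠ z' → c v = c s' → ¬ G.Adj v z' →
      ∃ w, w ≠ z' ∧ ¬ (G.Adj v w ↔ G.Adj s' w) := by
    intro h v h₁ h₂ h₃ h₄ h₅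
    exact hdem (by grind) v (by grind) h₅
  clear hdem hc hd
  refine hG.bad c (hgood.extend ?_ ?_ ?_ ?_)
  all_goals simp only [hU, forall_eq_or_imp, forall_eq]
  · grind
  · by_cases h : d s = d s'
    · grind
    · obtain ⟨t, ht, htz⟩ := hiso h
      grind
  · intro u hu v hv huv hW
    refine ⟨by grind, fun h _ => ⟨z, by grind⟩, fun h h' => ?_⟩
    obtain rfl : u = s' := by grind
    by_cases h : c s = c u
    · exact ⟨z', by grind⟩
    · obtain ⟨w, hw⟩ := hdem' h v (by grind) (by grind) (by grind) huv.symm h'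
      grind
  · grind

theorem MinimalBad.apex_aux' (hG : MinimalBad G) {x z z' s s' : V} {d : V → Bool}
    (hU : ∀ v, v ∈ U ↔ v = x ∨ v = z ∨ v = z')
    (hx : ∀ w, G.Adj x w ↔ w = z ∨ w = z') (hz : ∀ w, G.Adj z w ↔ w = x ∨ w = z' ∨ w = s)
    (hz' : ∀ w, G.Adj z' w ↔ w = x ∨ w = z ∨ w = s') (hsx : s ≠ x) (hsx' : s' ≠ x) (hsz : s ≠ z')
    (hsz' : s' ≠ z) (hss : s ≠ s') (hd : Good (removeEdgesAt G U) d)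
    (hds : d s ≠ d s') {t' v : V} (ht' : G.Adj s' t')
    (htz' : t' ≠ z') (hvs : d v = d s) (hvz : ¬ G.Adj v z)
    (hv : ∀ w, w ≠ z → (G.Adj v w ↔ G.Adj s w)) :
    False := by
  classical
  have hirr : ∀ a b, G.Adj a b → a ≠ b := fun a b h => h.ne
  have hsym : ∀ a b, G.Adj a b → G.Adj b a := fun a b h => h.symm
  have e₁ : G.Adj x z := by grind
  have e₂ : G.Adj x z' := by grind
  have e₃ : G.Adj z z' := by grind
  have e₄ : G.Adj z s := by grind
  have e₅ : G.Adj z' s' := by grind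
  have n₁ := e₁.ne
  have n₂ := e₂.ne
  have n₃ := e₃.ne
  have n₄ := e₄.ne
  have n₅ := e₅.ne
  obtain ⟨c, hc, hcx, hcz, hcz'⟩ : ∃ c : V → Bool, (∀ v, v ∉ U → c v = d v) ∧
      c x = d s' ∧ c z = d s' ∧ c z' = d s :=
    ⟨fun v => if v = x then d s' else if v = z then d s' else if v = z' then d s else d v,
      by grind, by grind, by grind, by grind⟩
  have hgood := hd.recolour hc
  have hdom := hgood.dom
  have hcs := hc s (by grind)
  have hcs' := hc s' (by grind)
  have hcv := hc v (by grind)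
  simp only [removeEdgesAt_adj, hU] at hdom
  clear hc hd
  refine hG.bad c (hgood.extend ?_ ?_ ?_ ?_)
  all_goals simp only [hU, forall_eq_or_imp, forall_eq]
  · grind
  · grind
  · grind
  · obtain ⟨y, ⟨hy, -, hyU⟩, hyc⟩ := hdom s' t' (by grind)
    have hyv : G.Adj y z → y = s := by grind
    have hsv : G.Adj s s' → G.Adj v s' ∧ v ≠ z ∧ v ≠ s := by grind
    refine ⟨fun u hux huc hs _ _ _ => ?_, fun u hux huc hs _ _ _ => ?_,
      fun u hux huc hs _ _ _ => ?_⟩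
    · have h₁ := hs z' (by grind)
      have h₂ := hs s (by grind)
      have h₃ := hs y (by grind)
      grind
    · have h₁ := hs z' (by grind)
      have h₂ := hs s (by grind)
      have h₃ := hs v (by grind)
      grind
    · have h₁ := hs z (by grind)
      have h₂ := hs x (by grind)
      grind

/-- Adjust a good colouring so that `a` and `b` agree whenever one of them is isolated. -/
theorem Good.exists_eq_of_isolated (hc : Good G c) (a b : V) :
    ∃ d, Good G d ∧ (d a ≠ d b → (∃ w, G.Adj a w) ∧ ∃ w, G.Adj b w) := by
  classical
  by_cases ha : ∃ w, G.Adj a w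
  · by_cases hb : ∃ w, G.Adj b w
    · exact ⟨c, hc, fun _ => ⟨ha, hb⟩⟩
    · refine ⟨Function.update c b (c a), hc.congr fun v w h => ?_, ?_⟩
      · grind
      · grind
  · refine ⟨Function.update c a (c b), hc.congr fun v w h => ?_, ?_⟩
    · grind
    · grind

theorem MinimalBad.no_attached_of_apex (hG : MinimalBad G) {x z z' s s' q r : V}
    (hU : ∀ v, v ∈ U ↔ v = x ∨ v = z ∨ v = z')
    (hx : ∀ w, G.Adj x w ↔ w = z ∨ w = z') (hz : ∀ w, G.Adj z w ↔ w = x ∨ w = z' ∨ w = s)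
    (hz' : ∀ w, G.Adj z' w ↔ w = x ∨ w = z ∨ w = s') (hss : s ≠ s') (hsx' : s' ≠ x) (hsz' : s' ≠ z)
    (h : IsAttachedTriangle G U s q r z) : False := by
  have hsym : ∀ a b, G.Adj a b → G.Adj b a := fun a b h => h.symm
  obtain ⟨hpq, hqr, hpr, hpx, h1, h2, h3, hy, hl, hm, hr⟩ := h
  have n₁ := hpq.ne
  have n₂ := hpr.ne
  have n₃ := hqr.ne
  simp only [hU] at *
  by_cases hq : q = s'
  · subst hq
    exact hG.no_triangle_pair (g := r) hx hz hz' (by grind) (by grind) (by grind) (by grind)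
      (by grind) (by grind) (by grind) (by grind) (by grind) (by grind)
  by_cases hr : r = s'
  · subst hr
    exact hG.no_triangle_pair (g := q) hx hz hz' (by grind) (by grind) (by grind) (by grind)
      (by grind) (by grind) (by grind) (by grind) (by grind) (by grind)
  exact hG.no_pendant_triangle hpq hpr hqr (by grind) (by grind)

theorem MinimalBad.no_apex_triangle (hG : MinimalBad G) {x z z' : V}
    (hx : ∀ w, G.Adj x w ↔ w = z ∨ w = z') (hzz : G.Adj z z') : False := by
  have hirr : ∀ a b, G.Adj a b → a ≠ b := fun a b h => h.ne
  have hsym : ∀ a b, G.Adj a b → G.Adj b a := fun a b h => h.symm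
  have e₁ : G.Adj x z := by grind
  have e₂ : G.Adj x z' := by grind
  have n₁ := e₁.ne
  have n₂ := e₂.ne
  have n₃ := hzz.ne
  obtain ⟨s, hz⟩ := hG.exists_third e₁.symm hzz n₂
  obtain ⟨s', hz'⟩ := hG.exists_third e₂.symm hzz.symm n₁
  have e₄ : G.Adj z s := by grind
  have e₅ : G.Adj z' s' := by grind
  have n₄ := e₄.ne
  have n₅ := e₅.ne
  by_cases hs : s = x ∨ s = z'
  · exact hG.no_pendant_triangle e₂.symm hzz.symm e₁ (by grind) (by grind)
  by_cases hs' : s' = x ∨ s' = z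
  · exact hG.no_pendant_triangle e₁.symm hzz e₂ (by grind) (by grind)
  push Not at hs hs'
  by_cases hss : s = s'
  · subst hss
    exact hG.no_diamond hx hz hz' hs.1
  obtain ⟨U, hU⟩ : ∃ U : Set V, ∀ v, v ∈ U ↔ v = x ∨ v = z ∨ v = z' := ⟨{x, z, z'}, by simp⟩
  have hT : ∀ p q r y, ¬ IsAttachedTriangle G U p q r y := by
    rintro p q r y ⟨hpq, hqr, hpr, hpx, h1, h2, h3, hy, hl, hm, hr⟩
    have hy' := (hU y).1 hy
    have h1' := (hU p).not.1 h1
    obtain ⟨rfl, rfl⟩ | ⟨rfl, rfl⟩ : p = s ∧ y = z ∨ p = s' ∧ y = z' := by grind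
    · exact hG.no_attached_of_apex hU hx hz hz' hss hs'.1 hs'.2
        ⟨hpq, hqr, hpr, hpx, h1, h2, h3, hy, hl, hm, hr⟩
    · exact hG.no_attached_of_apex (z' := z) (by grind) (by grind) (by grind) (by grind)
        (Ne.symm hss) hs.1 hs.2 ⟨hpq, hqr, hpr, hpx, h1, h2, h3, hy, hl, hm, hr⟩
  obtain ⟨d₀, hd₀⟩ := hG.exists_good_of_not_attached (by grind) hzz hT
  obtain ⟨d, hd, hiso⟩ := hd₀.exists_eq_of_isolated s s'
  simp only [removeEdgesAt_adj, hU] at hiso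
  by_cases h : d s ≠ d s' →
      ∀ v, d v = d s' → ¬ G.Adj v z' → ∃ w, w ≠ z' ∧ ¬ (G.Adj v w ↔ G.Adj s' w)
  · exact hG.apex_aux hU hx hz hz' hs.1 hs'.1 hs.2 hs'.2 hss hd (by grind) h
  by_cases h' : d s' ≠ d s →
      ∀ v, d v = d s → ¬ G.Adj v z → ∃ w, w ≠ z ∧ ¬ (G.Adj v w ↔ G.Adj s w)
  · exact hG.apex_aux (U := U) (z := z') (z' := z) (by grind) (by grind) (by grind) (by grind)
      hs'.1 hs.1 hs'.2 hs.2 (Ne.symm hss) hd (by grind) h'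
  push Not at h h'
  obtain ⟨hne, -⟩ := h
  obtain ⟨-, v, hv⟩ := h'
  obtain ⟨-, t, ht⟩ := hiso hne
  exact hG.apex_aux' (t' := t) (v := v) hU hx hz hz' hs.1 hs'.1 hs.2 hs'.2 hss hd hne
    (by grind) (by grind) (by grind) (by grind) (by grind)

/-- The neighbourhood of `x` is that of the non-isolated vertex `y` together with the extra
vertex `z`. -/
structure IsFlag (G : SimpleGraph V) (z x y : V) : Prop where
  left : G.Adj x z
  right : ¬ G.Adj y z
  nonempty : ∃ q, G.Adj y q
  iff : ∀ w, w ≠ z → (G.Adj x w ↔ G.Adj y w)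

theorem MinimalBad.edge_aux (hG : MinimalBad G) {z z' : V} {d : V → Bool} (k : Bool)
    (hU : ∀ v, v ∈ U ↔ v = z ∨ v = z') (hz : G.Adj z z')
    (hiso : ∀ v w, v ≠ z → v ≠ z' → G.Adj v w → ∃ t, G.Adj v t ∧ t ≠ z ∧ t ≠ z')
    (hflag : ∀ x y, ¬ IsFlag G z x y) (hflag' : ∀ x y, ¬ IsFlag G z' x y)
    (hd : Good (removeEdgesAt G U) d)
    (h₁ : ∀ x, x ≠ z → x ≠ z' → d x = k → G.Adj x z' →
      ∃ w, w ≠ z ∧ w ≠ z' ∧ d w ≠ k ∧ ¬ (G.Adj x w ↔ G.Adj z w))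
    (h₂ : ∀ x, x ≠ z → x ≠ z' → d x = !k → G.Adj x z →
      ∃ w, w ≠ z ∧ w ≠ z' ∧ d w = k ∧ ¬ (G.Adj x w ↔ G.Adj z' w)) : False := by
  classical
  have n₁ := hz.ne
  obtain ⟨c, hc, hcz, hcz'⟩ : ∃ c : V → Bool, (∀ v, v ∉ U → c v = d v) ∧
      c z = k ∧ c z' = !k :=
    ⟨fun v => if v = z then k else if v = z' then !k else d v, by grind, by grind, by grind⟩
  have hgood := hd.recolour hc
  simp only [hU] at hc
  refine hG.bad c (hgood.extend ?_ ?_ ?_ ?_)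
  all_goals simp only [hU, forall_eq_or_imp, forall_eq]
  · exact ⟨fun _ _ => ⟨z', by grind⟩, fun _ _ => ⟨z, hz.symm, by grind⟩⟩
  · grind
  · intro u hu v hv huv hW
    refine ⟨fun h h' => ?_, fun h h' => ?_⟩
    · by_contra hn
      have hn₁ := fun h => hn ⟨z, h⟩
      have hn₂ := fun h => hn ⟨z', h⟩
      refine hflag u v ⟨h, h', ?_, fun w hw => ?_⟩
      · obtain ⟨t, ht⟩ := hiso u z (by grind) (by grind) h
        exact ⟨t, (hW t (by grind)).1 ht.1⟩
      · by_cases hw' : w = z' <;> grind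
    · by_contra hn
      have hn₁ := fun h => hn ⟨z, h⟩
      have hn₂ := fun h => hn ⟨z', h⟩
      refine hflag' u v ⟨h, h', ?_, fun w hw => ?_⟩
      · obtain ⟨t, ht⟩ := hiso u z' (by grind) (by grind) h
        exact ⟨t, (hW t (by grind)).1 ht.1⟩
      · by_cases hw' : w = z <;> grind
  · refine ⟨fun u hux huc hs _ _ _ => ?_, fun u hux huc hs _ _ _ => ?_⟩
    · have h₂ := (hs z' (by grind)).1 hz
      obtain ⟨w, hw⟩ := h₁ u (by grind) (by grind) (by grind) h₂
      have := hs w (by grind)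
      grind
    · have h₂' := (hs z (by grind)).1 hz.symm
      obtain ⟨w, hw⟩ := h₂ u (by grind) (by grind) (by grind) h₂'
      have := hs w (by grind)
      grind

/-- The edge `zz'` is the middle edge of a ladder with three rungs. -/
structure IsDominoMiddle (G : SimpleGraph V) (z z' a b x y : V) : Prop where
  left : ∀ w, G.Adj z w ↔ w = z' ∨ w = a ∨ w = b
  right : ∀ w, G.Adj z' w ↔ w = z ∨ w = x ∨ w = y
  ax : G.Adj a x
  by' : G.Adj b y
  ab : a ≠ b
  xy : x ≠ y
  ay : a ≠ y
  bx : b ≠ x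
  az : a ≠ z'
  bz : b ≠ z'
  xz : x ≠ z
  yz : y ≠ z

theorem MinimalBad.domino_of_adj (hG : MinimalBad G) {z z' a b x y : V} (hz : G.Adj z z')
    (hza : G.Adj z a) (hzb : G.Adj z b) (hx : G.Adj z' x) (hy : G.Adj z' y) (hab : a ≠ b)
    (hxy : x ≠ y) (haz : a ≠ z') (hbz : b ≠ z') (hxz : x ≠ z) (hyz : y ≠ z) (hax : G.Adj a x)
    (hby : G.Adj b y) : IsDominoMiddle G z z' a b x y := by
  have hsym : ∀ a b, G.Adj a b → G.Adj b a := fun a b h => h.symm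
  have hay : a ≠ y := by
    rintro rfl
    have := hG.subcubic a z z' x b
    have := hG.noK4 z z' a b
    have := hz.ne
    have := hx.ne
    have := hy.ne
    have := hzb.ne
    have := hza.ne
    grind
  have hbx : b ≠ x := by
    rintro rfl
    have := hG.subcubic b z z' a y
    have := hG.noK4 z z' a b
    have := hz.ne
    have := hx.ne
    have := hy.ne
    have := hzb.ne
    have := hza.ne
    grind
  refine ⟨fun w => ⟨fun h => ?_, by grind⟩, fun w => ⟨fun h => ?_, by grind⟩, hax, hby, hab, hxy,
    hay, hbx, haz, hbz, hxz, hyz⟩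
  · have := hG.subcubic z z' a b w hz hza hzb h
    grind
  · have := hG.subcubic z' z x y w hz.symm hx hy h
    grind

theorem MinimalBad.edge (hG : MinimalBad G) {z z' : V}
    (hU : ∀ v, v ∈ U ↔ v = z ∨ v = z') (hz : G.Adj z z')
    (hiso : ∀ v w, v ≠ z → v ≠ z' → G.Adj v w → ∃ t, G.Adj v t ∧ t ≠ z ∧ t ≠ z')
    (hflag : ∀ x y, ¬ IsFlag G z x y) (hflag' : ∀ x y, ¬ IsFlag G z' x y)
    (hT : ∀ p q r y, ¬ IsAttachedTriangle G U p q r y)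
    (hD : ∀ a b x y, ¬ IsDominoMiddle G z z' a b x y) : False := by
  obtain ⟨d, hd⟩ := hG.exists_good_of_not_attached ((hU z).2 (.inl rfl)) hz hT
  have hdom := hd.dom
  simp only [removeEdgesAt_adj, hU] at hdom
  have key : ∀ k : Bool,
      (∃ x, x ≠ z ∧ x ≠ z' ∧ d x = k ∧ G.Adj x z' ∧
        ∃ w, w ≠ z ∧ w ≠ z' ∧ d w ≠ k ∧ G.Adj x w ∧ G.Adj z w) ∨
      ∃ x, x ≠ z ∧ x ≠ z' ∧ d x = !k ∧ G.Adj x z ∧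
        ∃ w, w ≠ z ∧ w ≠ z' ∧ d w = k ∧ G.Adj x w ∧ G.Adj z' w := by
    intro k
    by_contra hn
    push Not at hn
    refine hG.edge_aux k hU hz hiso hflag hflag' hd (fun x h₁ h₂ h₃ h₄ => ?_)
      (fun x h₁ h₂ h₃ h₄ => ?_)
    · obtain ⟨t, ht⟩ := hiso x z' h₁ h₂ h₄
      obtain ⟨w, ⟨hxw, -, hw⟩, hwd⟩ := hdom x t ⟨ht.1, by tauto, by tauto⟩
      have := hn.1 x h₁ h₂ h₃ h₄ w (by tauto) (by tauto) (by rwa [← h₃]) hxw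
      exact ⟨w, by tauto, by tauto, by rwa [← h₃], by tauto⟩
    · obtain ⟨t, ht⟩ := hiso x z h₁ h₂ h₄
      obtain ⟨w, ⟨hxw, -, hw⟩, hwd⟩ := hdom x t ⟨ht.1, by tauto, by tauto⟩
      have hwk : d w = k := by
        rw [h₃] at hwd
        simpa using hwd
      have := hn.2 x h₁ h₂ h₃ h₄ w (by tauto) (by tauto) hwk hxw
      exact ⟨w, by tauto, by tauto, hwk, by tauto⟩
  have hsym : ∀ a b, G.Adj a b → G.Adj b a := fun a b h => h.symm
  obtain ⟨x, hx⟩ | ⟨x, hx⟩ := key true <;> obtain ⟨y, hy⟩ | ⟨y, hy⟩ := key false <;>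
    obtain ⟨-, -, -, -, w, hw⟩ := id hx <;> obtain ⟨-, -, -, -, v, hv⟩ := id hy
  · exact hD w v x y (hG.domino_of_adj hz (by grind) (by grind) (by grind) (by grind) (by grind)
      (by grind) (by grind) (by grind) (by grind) (by grind) (by grind) (by grind))
  · exact hD w y x v (hG.domino_of_adj hz (by grind) (by grind) (by grind) (by grind) (by grind)
      (by grind) (by grind) (by grind) (by grind) (by grind) (by grind) (by grind))
  · exact hD x v w y (hG.domino_of_adj hz (by grind) (by grind) (by grind) (by grind) (by grind)
      (by grind) (by grind) (by grind) (by grind) (by grind) (by grind) (by grind))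
  · exact hD x y w v (hG.domino_of_adj hz (by grind) (by grind) (by grind) (by grind) (by grind)
      (by grind) (by grind) (by grind) (by grind) (by grind) (by grind) (by grind))

theorem IsFlag.ne {z x y : V} (h : IsFlag G z x y) : y ≠ x := fun e => h.right (e ▸ h.left)

theorem IsFlag.not_adj {z x y : V} (h : IsFlag G z x y) : ¬ G.Adj y x := fun e =>
  G.loopless.irrefl x ((h.iff x h.left.ne).2 e)

theorem IsFlag.ne_centre {z x y : V} (h : IsFlag G z x y) : y ≠ z := fun e =>
  h.not_adj (e ▸ h.left.symm)

/-- Two adjacent vertices cannot both be flagged at the same vertex. -/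
theorem MinimalBad.no_house (hG : MinimalBad G) {z x y x' y' : V} (hx : IsFlag G z x y)
    (hx' : IsFlag G z x' y') (hxx : G.Adj x x') : False := by
  classical
  have e₁ := hx.left
  have e₂ := hx'.left
  have n₁ := e₁.ne
  have n₂ := e₂.ne
  have n₃ := hxx.ne
  have n₄ := hx.ne
  have n₅ := hx'.ne
  have n₆ := hx.ne_centre
  have n₇ := hx'.ne_centre
  have r₁ := hx.right
  have r₂ := hx'.right
  have e₃ := (hx.iff x' n₂).1 hxx
  have e₄ := (hx'.iff x n₁).1 hxx.symm
  have e₅ : G.Adj y y' := ((hx'.iff y n₆).1 e₃.symm).symm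
  have n₈ := e₅.ne
  have n₉ := e₃.ne
  have n₁₀ := e₄.ne
  have ix : ∀ w, G.Adj x w ↔ w = z ∨ w = x' ∨ w = y' := fun w =>
    ⟨fun h => by have := hG.subcubic x z x' y' w e₁ hxx e₄.symm h; grind,
      by rintro (rfl | rfl | rfl); exacts [e₁, hxx, e₄.symm]⟩
  have ix' : ∀ w, G.Adj x' w ↔ w = z ∨ w = x ∨ w = y := fun w =>
    ⟨fun h => by have := hG.subcubic x' z x y w e₂ hxx.symm e₃.symm h; grind,
      by rintro (rfl | rfl | rfl); exacts [e₂, hxx.symm, e₃.symm]⟩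
  have iy : ∀ w, G.Adj y w ↔ w = x' ∨ w = y' := fun w => by
    by_cases hw : w = z
    · subst hw
      simp [r₁, n₂.symm, n₇.symm]
    · rw [← hx.iff w hw, ix]
      simp [hw]
  have iy' : ∀ w, G.Adj y' w ↔ w = x ∨ w = y := fun w => by
    by_cases hw : w = z
    · subst hw
      simp [r₂, n₁.symm, n₆.symm]
    · rw [← hx'.iff w hw, ix']
      simp [hw]
  obtain ⟨p, hp⟩ := exists_third hG e₁.symm e₂.symm n₃
  by_cases hpx : p = x ∨ p = x'
  · exact hG.no_apex_triangle (x := z) (z := x) (z' := x') (fun w => by grind) hxx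
  push Not at hpx
  have hzp : G.Adj z p := (hp p).2 (by simp)
  have n₁₁ := hzp.ne
  have hpy : p ≠ y := by rintro rfl; exact r₁ hzp.symm
  have hpy' : p ≠ y' := by rintro rfl; exact r₂ hzp.symm
  have hU : ∀ v, v ∈ ({x, x', y, y'} : Set V) ↔ v = x ∨ v = x' ∨ v = y ∨ v = y' := by simp
  generalize ({x, x', y, y'} : Set V) = U at hU
  obtain ⟨d, hd⟩ := hG.exists_good_of_not_attached ((hU x).2 (.inl rfl)) hxx (by
    intro t q r s h
    have hs := (hU s).1 h.hx
    have := h.left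
    have := h.px.symm
    have := h.hp
    have := h.hq
    have := h.hr
    have := h.pq
    have ht : t = z := by grind
    subst ht
    have := (h.left x).1 e₁.symm
    have := (h.left x').1 e₂.symm
    grind)
  obtain ⟨c, hc, cx, cx', cy, cy'⟩ : ∃ c : V → Bool, (∀ v, v ∉ U → c v = d v) ∧
      c x = (!d z) ∧ c x' = d z ∧ c y = d z ∧ c y' = !d z :=
    ⟨fun v => if v = x then !d z else if v = x' then d z else if v = y then d z else
      if v = y' then !d z else d v, by grind, by grind, by grind, by grind, by grind⟩
  have hz' := hc z (by grind)
  have hgood := hd.recolour hc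
  obtain ⟨w₀, ⟨hw₀, -, hw₀'⟩, hwc⟩ := hgood.dom z p ⟨hzp, by grind, by grind⟩
  have hw₀p : w₀ = p := by grind
  subst hw₀p
  clear hd
  refine hG.bad c (hgood.extend ?_ ?_ ?_ ?_)
  all_goals clear hc hgood
  all_goals simp only [hU]
  · rintro u (rfl | rfl | rfl | rfl) _ _
    · exact ⟨x', by grind⟩
    · exact ⟨x, by grind⟩
    · exact ⟨y', by grind⟩
    · exact ⟨y, by grind⟩
  · intro u hu w hw h
    have := h w hw
    have := hw.symm
    have hz : u = z := by grind
    subst hz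
    grind
  · intro u hu v hv huv hW t ht hut hvt
    have := hut.symm
    have hz : u = z := by grind
    subst hz
    have hvx : ¬ G.Adj v x := fun h => by
      have := (ix v).1 h.symm
      grind
    exact ⟨x, by simp, by simp [hvx, e₁.symm], by simp [cx, hz']⟩
  · rintro u (rfl | rfl | rfl | rfl) v hv hcv hs _ _ _
    · have := ((hs x' (by grind)).1 hxx).symm
      grind
    · have := ((hs x (by grind)).1 hxx.symm).symm
      have := hs w₀ (by grind)
      grind
    · have := ((hs y' (by grind)).1 e₅).symm
      grind
    · have := ((hs y (by grind)).1 e₅.symm).symm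
      grind

theorem MinimalBad.flag_unique (hG : MinimalBad G) {z x y y' : V} (h : IsFlag G z x y)
    (h' : IsFlag G z x y') : y = y' := by
  by_contra hne
  obtain ⟨q, hq⟩ := h.nonempty
  refine hG.no_twins hne hq fun w => ?_
  by_cases hw : w = z
  · subst hw
    simp [h.right, h'.right]
  · rw [← h.iff w hw, h'.iff w hw]

theorem MinimalBad.flag_disjoint (hG : MinimalBad G) {z x x' y y' w : V} (h : IsFlag G z x y)
    (h' : IsFlag G z x' y') (hx : x ≠ x') (hw : w ≠ z) (hxw : G.Adj x w) : ¬ G.Adj x' w := by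
  intro hxw'
  have hy : y ≠ y' := by
    rintro rfl
    refine hG.no_twins hx hxw fun v => ?_
    by_cases hv : v = z
    · subst hv
      simp [h.left, h'.left]
    · rw [h.iff v hv, h'.iff v hv]
  have := hG.subcubic w x x' y y' hxw.symm hxw'.symm ((h.iff w hw).1 hxw).symm
    ((h'.iff w hw).1 hxw').symm
  have := h.ne
  have := h'.ne
  have h₁ : x ≠ y' := by
    rintro rfl
    exact h'.right h.left
  have h₂ : x' ≠ y := by
    rintro rfl
    exact h.right h'.left
  grind

theorem MinimalBad.flag_not_adj (hG : MinimalBad G) {z x y w : V}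
    (hU : ∀ v, v ∈ U ↔ v = z ∨ ∃ y, IsFlag G z v y) (h : IsFlag G z x y) (hw : w ∈ U) :
    ¬ G.Adj y w := by
  rcases (hU w).1 hw with rfl | ⟨y', hy'⟩
  · exact h.right
  · exact fun hyw => hG.no_house h hy' ((h.iff w hy'.left.ne).2 hyw)

theorem IsFlag.not_mem {z x y : V} (hU : ∀ v, v ∈ U ↔ v = z ∨ ∃ y, IsFlag G z v y)
    (h : IsFlag G z x y) : y ∉ U := by
  intro hy
  rcases (hU y).1 hy with hy | ⟨y', hy'⟩
  · exact h.ne_centre hy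
  · exact h.right hy'.left

theorem MinimalBad.no_attached_flag_centre (hG : MinimalBad G) {z : V}
    (hU : ∀ v, v ∈ U ↔ v = z ∨ ∃ y, IsFlag G z v y) (p q r x : V) :
    ¬ IsAttachedTriangle G U p q r x := by
  have key : ∀ p q r x y, IsFlag G z x y → p ∉ U → G.Adj p q → G.Adj q r → G.Adj p r →
      (∀ w, G.Adj p w → w = q ∨ w = r ∨ w ∈ U) → (∀ w, G.Adj q w → w = p ∨ w = r ∨ w ∈ U) →
      (∀ w, G.Adj r w → w = p ∨ w = q ∨ w ∈ U) → ¬ G.Adj p x := by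
    intro p q r x y h hp hpq hqr hpr h₁ h₂ h₃ hpx
    have hpy := (h.iff p (fun e => hp ((hU p).2 (.inl e)))).1 hpx.symm
    have hy := h.not_mem hU
    have hyU := fun w => hG.flag_not_adj hU (w := w) h
    obtain rfl | rfl : y = q ∨ y = r := by have := h₁ y hpy.symm; tauto
    · exact hG.no_apex_triangle (x := y) (z := p) (z' := r) (fun w => ⟨fun hw => by
        have := h₂ w hw; have := hyU w; tauto, by rintro (rfl | rfl); exacts [hpq.symm, hqr]⟩) hpr
    · exact hG.no_apex_triangle (x := y) (z := p) (z' := q) (fun w => ⟨fun hw => by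
        have := h₃ w hw; have := hyU w; tauto, by rintro (rfl | rfl); exacts [hpr.symm, hqr.symm]⟩)
        hpq
  intro h
  have h₁ : ∀ w, G.Adj p w → w = q ∨ w = r ∨ w ∈ U := fun w hw => by
    rcases (h.left w).1 hw with rfl | rfl | rfl
    exacts [.inl rfl, .inr (.inl rfl), .inr (.inr h.hx)]
  rcases (hU x).1 h.hx with rfl | ⟨y, hy⟩
  swap
  · exact key p q r x y hy h.hp h.pq h.qr h.pr h₁ h.mid h.right h.px
  have hq : G.Adj q x := by
    by_contra hn
    refine hG.no_apex_triangle (x := q) (z := p) (z' := r) (fun w => ⟨fun hw => ?_, ?_⟩) h.pr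
    · rcases h.mid w hw with rfl | rfl | hwU
      · simp
      · simp
      · rcases (hU w).1 hwU with rfl | ⟨y, hy⟩
        · exact absurd hw hn
        · exact absurd hw (key q p r w y hy h.hq h.pq.symm h.pr h.qr h.mid h₁
            fun v hv => by have := h.right v hv; tauto)
    · rintro (rfl | rfl)
      exacts [h.pq.symm, h.qr]
  have hr : G.Adj r x := by
    by_contra hn
    refine hG.no_apex_triangle (x := r) (z := p) (z' := q) (fun w => ⟨fun hw => ?_, ?_⟩) h.pq
    · rcases h.right w hw with rfl | rfl | hwU
      · simp
      · simp
      · rcases (hU w).1 hwU with rfl | ⟨y, hy⟩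
        · exact absurd hw hn
        · exact absurd hw (key r p q w y hy h.hr h.pr.symm h.pq h.qr.symm h.right
            (fun v hv => by have := h₁ v hv; tauto) fun v hv => by have := h.mid v hv; tauto)
    · rintro (rfl | rfl)
      exacts [h.pr.symm, h.qr.symm]
  exact hG.noK4 p q r x h.pq h.pr h.px h.qr hq hr

theorem MinimalBad.flag_centre_aux (hG : MinimalBad G) {z x₀ y₀ : V} {d : V → Bool} (k : Bool)
    (hU : ∀ v, v ∈ U ↔ v = z ∨ ∃ y, IsFlag G z v y) (h₀ : IsFlag G z x₀ y₀) (hk : d y₀ = !k)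
    (hd : Good (removeEdgesAt G U) d)
    (h₁ : ∀ x y x' y', IsFlag G z x y → IsFlag G z x' y' → d y = k → d y' = k → x = x')
    (h₂ : ∀ x y v, IsFlag G z x y → d y = k → G.Adj z v → v ∉ U →
      (∃ w, G.Adj v w ∧ w ≠ z) ∧ d v = k) : False := by
  classical
  have hzU : z ∈ U := (hU z).2 (.inl rfl)
  have hXU : ∀ x y, IsFlag G z x y → x ∈ U := fun x y h => (hU x).2 (.inr ⟨y, h⟩)
  obtain ⟨c, hc, hcz, hcX, hcL⟩ : ∃ c : V → Bool,
      (∀ v, v ∉ U → (∃ w, G.Adj v w ∧ w ≠ z) → c v = d v) ∧ c z = k ∧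
      (∀ x y, IsFlag G z x y → c x = !k) ∧
      ∀ v, v ∉ U → (∀ w, G.Adj v w → w = z) → c v = !k := by
    refine ⟨fun v => if v = z then k else if v ∈ U ∨ ∀ w, G.Adj v w → w = z then !k else d v,
      fun v hv ⟨w, hw⟩ => ?_, by simp, fun x y h => ?_, fun v hv hw => ?_⟩
    · have : v ≠ z := fun e => hv (e ▸ hzU)
      have hn : ¬ ∀ w, G.Adj v w → w = z := fun h => hw.2 (h w hw.1)
      simp only [this, hv, hn, or_self, if_false]
    · simp [h.left.ne, hXU x y h]
    · have : v ≠ z := fun e => hv (e ▸ hzU)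
      simp only [this, if_false]
      rw [if_pos (.inr hw)]
  have hgood : Good (removeEdgesAt G U) c := hd.congr fun v w hvw =>
    hc v hvw.2.1 ⟨w, hvw.1, fun e => hvw.2.2 (e ▸ hzU)⟩
  have hyc : ∀ x y, IsFlag G z x y → c y = d y := fun x y h => by
    obtain ⟨q, hq⟩ := h.nonempty
    exact hc y (h.not_mem hU) ⟨q, hq, fun e => h.right (e ▸ hq)⟩
  have hyU := fun x y w => hG.flag_not_adj hU (x := x) (y := y) (w := w)
  have hydom : ∀ x y, IsFlag G z x y → d y = !k → ∃ w, G.Adj y w ∧ w ∉ U ∧ c w = k :=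
    fun x y h hy => by
      obtain ⟨q, hq⟩ := h.nonempty
      obtain ⟨w, hw, hwc⟩ := hgood.dom y q ⟨hq, h.not_mem hU, fun hq' => hyU x y q h hq' hq⟩
      refine ⟨w, hw.1, hw.2.2, ?_⟩
      rw [hyc x y h, hy] at hwc
      simpa using hwc
  have hne : ∀ u, u ∉ U → u ≠ z := fun u hu e => hu (e ▸ hzU)
  have hleaf : ∀ u, u ∉ U → (∀ w, G.Adj u w → w ∈ U) → ∀ w, G.Adj u w → w = z := by
    intro u hu h w hw
    rcases (hU w).1 (h w hw) with e | ⟨y, hy⟩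
    · exact e
    · exact absurd (h y ((hy.iff u (hne u hu)).1 hw.symm).symm) (hy.not_mem hU)
  refine hG.bad c (hgood.extend ?_ ?_ ?_ ?_)
  · intro u hu _ _
    rcases (hU u).1 hu with rfl | ⟨y, hy⟩
    · exact ⟨x₀, h₀.left.symm, by simp [hcX x₀ y₀ h₀, hcz]⟩
    · exact ⟨z, hy.left, by simp [hcX u y hy, hcz]⟩
  · intro u hu w huw h
    have := hleaf u hu h
    exact ⟨w, huw, by rw [this w huw, hcz, hcL u hu this]; simp⟩
  · intro u hu v hv huv hW t ht hut hvt
    rcases (hU t).1 ht with rfl | ⟨y, hy⟩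
    · by_cases hu' : ∀ w, G.Adj u w → w = t
      · exact ⟨t, ht, by simp [hut, hvt], by simp [hcL u hu hu', hcz]⟩
      · push Not at hu'
        obtain ⟨w₀, hw₀, hw₀t⟩ := hu'
        have hX : ∀ x y, IsFlag G t x y → (G.Adj u x ↔ G.Adj v x) := fun x y h => by
          rw [G.adj_comm u, G.adj_comm v, h.iff u (hne u hu), h.iff v (hne v hv),
            G.adj_comm y, G.adj_comm y]
          exact hW y (h.not_mem hU)
        have hiff : ∀ w, w ≠ t → (G.Adj u w ↔ G.Adj v w) := fun w hw => by
          by_cases hwU : w ∈ U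
          · rcases (hU w).1 hwU with e | ⟨y, hy⟩
            · exact absurd e hw
            · exact hX w y hy
          · exact hW w hwU
        exact absurd (hXU u v ⟨hut, hvt, ⟨w₀, (hiff w₀ hw₀t).1 hw₀⟩, hiff⟩) hu
    · refine absurd ?_ hvt
      rw [G.adj_comm, hy.iff v (hne v hv), G.adj_comm, ← hW y (hy.not_mem hU), G.adj_comm,
        ← hy.iff u (hne u hu)]
      exact hut.symm
  · intro u hu v hvu hcol hs _ _ _
    rcases (hU u).1 hu with rfl | ⟨y, hy⟩
    · have h := (hs x₀ (by simp [hcX x₀ y₀ h₀, hcz])).1 h₀.left.symm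
      have h' := (h₀.iff v hvu).1 h.symm
      exact absurd ((hs y₀ (by simp [hyc x₀ y₀ h₀, hk, hcz])).2 h'.symm).symm h₀.right
    · have hcu := hcX u y hy
      have hvz := ((hs z (by simp [hcu, hcz])).1 hy.left).symm
      have huz := hy.left.ne
      -- a common neighbour of colour `k` in the case that the flag has the other colour
      have hk' : d y = (!k) → ∃ w, w ∉ U ∧ c w = k ∧ G.Adj u w := fun h => by
        obtain ⟨w, hw, hwU, hwc⟩ := hydom u y hy h
        exact ⟨w, hwU, hwc, (hy.iff w (hne w hwU)).2 hw⟩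
      by_cases hvU : v ∈ U
      · rcases (hU v).1 hvU with rfl | ⟨y', hy'⟩
        · exact absurd hvz (G.loopless.irrefl v)
        · by_cases h : d y = !k
          · obtain ⟨w, hwU, hwc, hw⟩ := hk' h
            exact absurd ((hs w (by simp [hcu, hwc])).1 hw)
              (hG.flag_disjoint hy hy' hvu.symm (hne w hwU) hw)
          · by_cases h' : d y' = !k
            · obtain ⟨w, hw, hwU, hwc⟩ := hydom v y' hy' h'
              have hw' := (hy'.iff w (hne w hwU)).2 hw
              exact absurd ((hs w (by simp [hcu, hwc])).2 hw')
                (hG.flag_disjoint hy' hy hvu (hne w hwU) hw')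
            · exact absurd (h₁ u y v y' hy hy' (by simpa using h) (by simpa using h')) hvu.symm
      · by_cases h : d y = !k
        · exfalso
          obtain ⟨w, hwU, hwc, hw⟩ := hk' h
          have hvw := (hs w (by simp [hcu, hwc])).1 hw
          have hW := hgood.sep y v (by rw [hyc u y hy, h, hcol, hcu]) fun w hw => by
            rw [hyc u y hy, h] at hw
            simp only [removeEdgesAt_adj, hvU, hy.not_mem hU]
            by_cases hwU : w ∈ U
            · simp [hwU]
            · rw [← hs w (by rwa [hcu]), hy.iff w (hne w hwU)]
          simp only [removeEdgesAt_adj, hvU, hy.not_mem hU, not_false_eq_true, true_and] at hW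
          have hvX : ∀ x' y', IsFlag G z x' y' → ¬ G.Adj v x' := fun x' y' h' hv' => by
            have h₁ := (h'.iff v (hne v hvU)).1 hv'.symm
            have h₂ := ((hW y').2 ⟨h₁.symm, h'.not_mem hU⟩).1
            exact hyU u y x' hy (hXU x' y' h') ((h'.iff y hy.ne_centre).2 h₂.symm).symm
          refine hvU (hXU v y ⟨hvz.symm, hy.right, hy.nonempty, fun w hw' => ?_⟩)
          by_cases hwU : w ∈ U
          · rcases (hU w).1 hwU with e | ⟨y', h'⟩
            · exact absurd e hw'
            · exact iff_of_false (hvX w y' h') (hyU u y w hy hwU)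
          · simpa [hwU] using (hW w).symm
        · have := h₂ u y v hy (by simpa using h) hvz hvU
          have hcv := hc v hvU this.1
          rw [this.2, hcol, hcu] at hcv
          simp at hcv

/-- Every centre of a flag has a leaf neighbour, and its two other neighbours are flagged. -/
theorem MinimalBad.flag_centre (hG : MinimalBad G) {z x y : V} (h : IsFlag G z x y) :
    ∃ p x' y', (∀ w, G.Adj z w ↔ w = p ∨ w = x ∨ w = x') ∧ (∀ w, G.Adj p w ↔ w = z) ∧
      p ≠ x ∧ p ≠ x' ∧ x' ≠ x ∧ IsFlag G z x' y' := by
  obtain ⟨U, hU⟩ : ∃ U : Set V, ∀ v, v ∈ U ↔ v = z ∨ ∃ y, IsFlag G z v y :=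
    ⟨{v | v = z ∨ ∃ y, IsFlag G z v y}, fun _ => Iff.rfl⟩
  obtain ⟨d, hd⟩ := hG.exists_good_of_not_attached ((hU z).2 (.inl rfl)) h.left.symm
    (hG.no_attached_flag_centre hU)
  by_cases hx' : ∃ x' y', IsFlag G z x' y' ∧ d y' ≠ d y
  swap
  · push Not at hx'
    refine (hG.flag_centre_aux (!d y) hU h (by simp) hd (fun x₁ y₁ _ _ h₁ _ hd' => ?_)
      (fun x₁ y₁ _ h₁ hd' => ?_)).elim <;>
    · rw [hx' x₁ y₁ h₁] at hd'
      simp at hd'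
  obtain ⟨x', y', h', hdy⟩ := hx'
  have hxx : x' ≠ x := by
    rintro rfl
    exact hdy (by rw [hG.flag_unique h h'])
  obtain ⟨p, hp⟩ := exists_third hG h.left.symm h'.left.symm hxx.symm
  have hy' : d y' = !d y := by
    revert hdy
    cases d y' <;> cases d y <;> simp
  have key : ∀ u v, IsFlag G z u v → u = x ∧ v = y ∨ u = x' ∧ v = y' ∨ u = p ∧ u ≠ x ∧ u ≠ x' := by
    intro u v huv
    by_cases hux : u = x
    · subst hux
      exact .inl ⟨rfl, hG.flag_unique huv h⟩
    by_cases hux' : u = x'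
    · subst hux'
      exact .inr (.inl ⟨rfl, hG.flag_unique huv h'⟩)
    · have := (hp u).1 huv.left.symm
      tauto
  have hxU : x ∈ U := (hU x).2 (.inr ⟨y, h⟩)
  have hxU' : x' ∈ U := (hU x').2 (.inr ⟨y', h'⟩)
  by_cases hpp : p = x ∨ p = x'
  · refine (hG.flag_centre_aux (!d y) hU h (by simp) hd (fun u v u' v' h₁ h₂ hv hv' => ?_)
      (fun _ _ v _ _ hv hvU => (hvU ?_).elim)).elim
    · have := key u v h₁
      have := key u' v' h₂
      grind
    · rcases (hp v).1 hv with rfl | rfl | rfl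
      · exact hxU
      · exact hxU'
      · rcases hpp with rfl | rfl
        · exact hxU
        · exact hxU'
  push Not at hpp
  by_cases hpf : ∃ y'', IsFlag G z p y''
  · obtain ⟨y'', h''⟩ := hpf
    refine (hG.flag_centre_aux (!d y'') hU h'' (by simp) hd (fun u v u' v' h₁ h₂ hv hv' => ?_)
      (fun _ _ v _ _ hv hvU => (hvU ?_).elim)).elim
    · have := key u v h₁
      have := key u' v' h₂
      have : ∀ y₁, IsFlag G z p y₁ → y₁ = y'' := fun y₁ h₁ => hG.flag_unique h₁ h''
      grind
    · rcases (hp v).1 hv with rfl | rfl | rfl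
      · exact hxU
      · exact hxU'
      · exact (hU v).2 (.inr ⟨y'', h''⟩)
  by_cases hleaf : ∀ w, G.Adj p w → w = z
  · have hzp : G.Adj z p := (hp p).2 (by simp)
    exact ⟨p, x', y', fun w => by rw [hp]; tauto,
      fun w => ⟨hleaf w, by rintro rfl; exact hzp.symm⟩, hpp.1, hpp.2, hxx, h'⟩
  push Not at hleaf
  have h₁ : ∀ u v u' v', IsFlag G z u v → IsFlag G z u' v' → d v = d p → d v' = d p →
      u = u' := fun u v u' v' h₁ h₂ hv hv' => by
    have := key u v h₁
    have := key u' v' h₂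
    grind
  have h₂ : ∀ x y v, IsFlag G z x y → d y = d p → G.Adj z v → v ∉ U →
      (∃ w, G.Adj v w ∧ w ≠ z) ∧ d v = d p := fun _ _ v _ _ hv hvU => by
    rcases (hp v).1 hv with rfl | rfl | rfl
    · exact absurd hxU hvU
    · exact absurd hxU' hvU
    · exact ⟨hleaf, rfl⟩
  by_cases hdp : d p = d y
  · exact (hG.flag_centre_aux (d p) hU h' (by rw [hy', hdp]) hd h₁ h₂).elim
  · refine (hG.flag_centre_aux (d p) hU h ?_ hd h₁ h₂).elim
    revert hdp
    cases d p <;> cases d y <;> simp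

theorem MinimalBad.leaf_unique (hG : MinimalBad G) {z p p' : V} (hp : ∀ w, G.Adj p w ↔ w = z)
    (hp' : ∀ w, G.Adj p' w ↔ w = z) : p = p' := by
  by_contra hne
  exact hG.no_twins hne ((hp z).2 rfl) fun w => by rw [hp, hp']

theorem MinimalBad.exists_flag_of_leaf (hG : MinimalBad G) {z p : V}
    (hp : ∀ w, G.Adj p w ↔ w = z) : ∃ x y, IsFlag G z x y := by
  classical
  by_contra hflag
  push Not at hflag
  have e₁ := (hp z).2 rfl
  have n₁ := e₁.ne
  have hU : ∀ v, v ∈ ({p, z} : Set V) ↔ v = p ∨ v = z := by simp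
  generalize ({p, z} : Set V) = U at hU
  have hpU := (hU p).2 (.inl rfl)
  have hzU := (hU z).2 (.inr rfl)
  have hiso : ∀ v, v ∉ U → G.Adj v z → ∃ w, G.Adj v w ∧ w ∉ U := by
    intro v hv hvz
    by_contra hn
    push Not at hn
    refine hv ((hU v).2 (.inl (hG.leaf_unique (fun w => ⟨fun hw => ?_, ?_⟩) hp)))
    · rcases (hU w).1 (hn w hw) with rfl | e
      · exact absurd ((hU v).2 (.inr ((hp v).1 hw.symm))) hv
      · exact e
    · rintro rfl
      exact hvz
  obtain ⟨d, hd⟩ := hG.exists_good_of_not_attached hpU e₁ (by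
    intro a b e s h
    have h' : ∀ v, v ∉ U → ∀ w, G.Adj v w → w ∈ U → w = z := fun v hv w hvw hw => by
      rcases (hU w).1 hw with rfl | e
      · exact absurd ((hU v).2 (.inr ((hp v).1 hvw.symm))) hv
      · exact e
    have haz : G.Adj a z := by
      rw [← h' a h.hp s h.px h.hx]
      exact h.px
    have hb : G.Adj b z := by
      by_contra hn
      refine hG.no_apex_triangle (x := b) (z := a) (z' := e) (fun w => ⟨fun hw => ?_, ?_⟩) h.pr
      · rcases h.mid w hw with e | e | hwU
        · exact .inl e
        · exact .inr e
        · exact absurd (h' b h.hq w hw hwU ▸ hw) hn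
      · rintro (rfl | rfl)
        exacts [h.pq.symm, h.qr]
    have he : G.Adj e z := by
      by_contra hn
      refine hG.no_apex_triangle (x := e) (z := a) (z' := b) (fun w => ⟨fun hw => ?_, ?_⟩) h.pq
      · rcases h.right w hw with e | e | hwU
        · exact .inl e
        · exact .inr e
        · exact absurd (h' e h.hr w hw hwU ▸ hw) hn
      · rintro (rfl | rfl)
        exacts [h.pr.symm, h.qr.symm]
    exact hG.noK4 a b e z h.pq h.pr haz h.qr hb he)
  obtain ⟨c, hc, cp, cz⟩ : ∃ c : V → Bool, (∀ v, v ∉ U → c v = d v) ∧ c p = false ∧ c z = true :=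
    ⟨fun v => if v = p then false else if v = z then true else d v, by grind, by grind, by grind⟩
  have hgood := hd.recolour hc
  have hdom : ∀ v, v ∉ U → G.Adj v z → ∃ w, G.Adj v w ∧ w ∉ U ∧ c w ≠ c v := fun v hv hvz => by
    obtain ⟨w, hw⟩ := hiso v hv hvz
    obtain ⟨w', hw', hc'⟩ := hgood.dom v w ⟨hw.1, hv, hw.2⟩
    exact ⟨w', hw'.1, hw'.2.2, hc'⟩
  have hleaf : ∀ v, v ∉ U → ¬ G.Adj v p := fun v hv hvp => hv ((hU v).2 (.inr ((hp v).1 hvp.symm)))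
  have hz : ∀ v w, v ∉ U → G.Adj v w → w ∈ U → w = z := fun v w hv hvw hw => by
    rcases (hU w).1 hw with rfl | e
    · exact absurd hvw (hleaf v hv)
    · exact e
  refine hG.bad c (hgood.extend ?_ ?_ ?_ ?_)
  · intro u hu _ _
    rcases (hU u).1 hu with rfl | rfl
    · exact ⟨z, e₁, by simp [cp, cz]⟩
    · exact ⟨p, e₁.symm, by simp [cp, cz]⟩
  · intro u hu w huw h
    obtain ⟨v, hv, hvU⟩ := hiso u hu (hz u w hu huw (h w huw) ▸ huw)
    exact absurd (h v hv) hvU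
  · intro u hu v hv _ hW t ht hut hvt
    obtain rfl := hz u t hu hut ht
    obtain ⟨w, hw, hwU⟩ := hiso u hu hut
    refine (hflag u v ⟨hut, hvt, ⟨w, (hW w hwU).1 hw⟩, fun w hw => ?_⟩).elim
    by_cases hwU : w ∈ U
    · exact iff_of_false (fun h => hw (hz u w hu h hwU)) (fun h => hw (hz v w hv h hwU))
    · exact hW w hwU
  · intro u hu v hvu hcol hs _ _ _
    rcases (hU u).1 hu with rfl | rfl
    · have hvz := (hs z (by simp [cp, cz])).1 e₁
      have hvU : v ∉ U := fun h => by
        rcases (hU v).1 h with h | h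
        · exact hvu h
        · exact hvz.ne h
      obtain ⟨w, hvw, hwU, hw⟩ := hdom v hvU hvz
      have := (hp w).1 ((hs w (by rwa [← hcol])).2 hvw)
      exact absurd (this ▸ hzU) hwU
    · exact absurd ((hp v).1 ((hs p (by simp [cp, cz])).1 e₁.symm).symm) hvu

theorem MinimalBad.leaf_support (hG : MinimalBad G) {z p : V} (hp : ∀ w, G.Adj p w ↔ w = z) :
    ∃ x y x' y', (∀ w, G.Adj z w ↔ w = p ∨ w = x ∨ w = x') ∧
      p ≠ x ∧ p ≠ x' ∧ x' ≠ x ∧ IsFlag G z x y ∧ IsFlag G z x' y' := by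
  obtain ⟨x, y, h⟩ := hG.exists_flag_of_leaf hp
  obtain ⟨p', x', y', h₁, h₂, h₃⟩ := hG.flag_centre h
  obtain rfl := hG.leaf_unique hp h₂
  exact ⟨x, y, x', y', h₁, h₃.1, h₃.2.1, h₃.2.2.1, h, h₃.2.2.2⟩

/-- The neighbours of a vertex `z` with a leaf `p` are `p` and two vertices `x` and `x'`, flagged
by `y` and `y'`, where `x` has degree three, and one of its two further neighbours, `q`, also has
degree three. -/
structure IsWideFlag (G : SimpleGraph V) (z p x x' y y' q q' e : V) : Prop where
  leaf : ∀ w, G.Adj p w ↔ w = z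
  centre : ∀ w, G.Adj z w ↔ w = p ∨ w = x ∨ w = x'
  left : ∀ w, G.Adj x w ↔ w = z ∨ w = q ∨ w = q'
  flag_left : ∀ w, G.Adj y w ↔ w = q ∨ w = q'
  right : ∀ w, G.Adj x' w ↔ w = z ∨ G.Adj y' w
  flag_right : ∃ w, G.Adj y' w
  outer : ∀ w, G.Adj q w ↔ w = x ∨ w = y ∨ w = e
  outer_nonleaf : ∃ w, G.Adj e w ∧ w ≠ q
  disjoint : ∀ w, G.Adj y' w → w ≠ z ∧ w ≠ p ∧ w ≠ x ∧ w ≠ x' ∧ w ≠ y ∧ w ≠ q ∧ w ≠ q'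
  not_flag : ∀ u v, ¬ IsFlag G q u v
  nodup : [z, p, x, x', y, y', q, q', e].Nodup

theorem MinimalBad.no_attached_wide_flag (hG : MinimalBad G) {z p x x' y y' q q' e : V}
    (h : IsWideFlag G z p x x' y y' q q' e)
    (hU : ∀ v, v ∈ U → v = z ∨ v = p ∨ v = x ∨ v = x' ∨ v = y ∨ v = q ∨ v = q')
    (hUx : x ∈ U) (hUy : y ∈ U) (hUz : z ∈ U) (hUx' : x' ∈ U) (hUq : q ∈ U)
    (hq' : ∀ v w, G.Adj q' v → G.Adj q' w → v ∉ U → w ∉ U → v = w)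
    (hq'U : q' ∈ U → ∀ w, G.Adj q' w → w ∈ U) (a b r s : V) :
    ¬ IsAttachedTriangle G U a b r s := by
  intro hT
  have hy'U : y' ∉ U := fun hy'U => by
    have hnd := h.nodup
    have := hU y' hy'U
    simp only [List.nodup_cons, List.mem_cons, List.not_mem_nil, or_false, not_or] at hnd
    grind
  -- a vertex of the triangle with a neighbour in `U` is the vertex `e`
  have key : ∀ a b r s, a ∉ U → b ∉ U → r ∉ U → G.Adj a b → G.Adj a r → G.Adj b r → s ∈ U →
      G.Adj a s → (∀ w, G.Adj a w → w = b ∨ w = r ∨ w ∈ U) →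
      (∀ w, G.Adj b w → w = a ∨ w = r ∨ w ∈ U) →
      (∀ w, G.Adj r w → w = a ∨ w = b ∨ w ∈ U) → a = e := by
    intro a b r s ha hb hr hab har hbr hs has h₁ h₂ h₃
    have haq : a ≠ q' := by
      rintro rfl
      exact hbr.ne (hq' b r hab har hb hr)
    have hay : ¬ G.Adj y' a := by
      intro hy
      have hyU : ∀ w, G.Adj y' w → w ∉ U := fun w hw hwU => by
        have := h.disjoint w hw
        have := hU w hwU
        grind
      obtain rfl | rfl : y' = b ∨ y' = r := by have := h₁ y' hy.symm; tauto
      · exact hG.no_apex_triangle (x := y') (z := a) (z' := r) (fun w => ⟨fun hw => by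
          have := h₂ w hw; have := hyU w hw; tauto, by rintro (rfl | rfl); exacts [hy, hbr]⟩) har
      · exact hG.no_apex_triangle (x := y') (z := a) (z' := b) (fun w => ⟨fun hw => by
          have := h₃ w hw; have := hyU w hw; tauto, by
            rintro (rfl | rfl); exacts [hy, hbr.symm]⟩) hab
    rcases hU s hs with rfl | rfl | rfl | rfl | rfl | rfl | rfl
    · have := (h.centre a).1 has.symm
      rcases this with rfl | rfl | rfl
      · exact absurd ((h.leaf b).1 hab) (fun e => hb (e ▸ hs))
      · exact absurd hUx ha
      · exact absurd hUx' ha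
    · exact absurd ((h.leaf a).1 has.symm) (fun e => ha (e ▸ hUz))
    · rcases (h.left a).1 has.symm with rfl | rfl | rfl
      exacts [absurd hUz ha, absurd hUq ha, absurd rfl haq]
    · rcases (h.right a).1 has.symm with rfl | hya
      exacts [absurd hUz ha, absurd hya hay]
    · rcases (h.flag_left a).1 has.symm with rfl | rfl
      exacts [absurd hUq ha, absurd rfl haq]
    · rcases (h.outer a).1 has.symm with rfl | rfl | rfl
      exacts [absurd hUx ha, absurd hUy ha, rfl]
    · exact absurd (hq'U hs a has.symm) ha
  have h₁ : ∀ w, G.Adj a w → w = b ∨ w = r ∨ w ∈ U := fun w hw => by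
    rcases (hT.left w).1 hw with rfl | rfl | rfl
    exacts [.inl rfl, .inr (.inl rfl), .inr (.inr hT.hx)]
  have ha := key a b r s hT.hp hT.hq hT.hr hT.pq hT.pr hT.qr hT.hx hT.px h₁ hT.mid hT.right
  refine hG.no_apex_triangle (x := b) (z := a) (z' := r) (fun w => ⟨fun hw => ?_, ?_⟩) hT.pr
  · by_contra hn
    push Not at hn
    have hwU : w ∈ U := by have := hT.mid w hw; tauto
    refine hT.pq.ne (ha.trans (key b a r w hT.hq hT.hp hT.hr hT.pq.symm hT.qr hT.pr hwU hw hT.mid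
      h₁ fun v hv => ?_).symm)
    have := hT.right v hv
    tauto
  · rintro (rfl | rfl)
    exacts [hT.pq.symm, hT.qr]

theorem MinimalBad.no_wide_flag_of_outer (hG : MinimalBad G) {z p x x' y y' q q' e e' : V}
    (h : IsWideFlag G z p x x' y y' q q' e) (h' : ∀ w, G.Adj q' w ↔ w = x ∨ w = y ∨ w = e')
    (hx : e' ≠ x) (hy : e' ≠ y) (he : e' ≠ e) : False := by
  classical
  have hnd := h.nodup
  simp only [List.nodup_cons, List.mem_cons, List.not_mem_nil, or_false, not_or, not_false_eq_true,
    List.nodup_nil, and_true] at hnd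
  obtain ⟨⟨zp, zx, zx', zy, zy', zq, zq', ze⟩, ⟨-, -, -, py', pq, pq', pe⟩, ⟨-, -, xy', xq, xq', xe⟩,
    ⟨-, x'y', x'q, x'q', x'e⟩, ⟨yy', yq, yq', ye⟩, ⟨y'q, -, -⟩, ⟨qq', qe⟩, q'e⟩ := hnd
  have hU : ∀ v, v ∈ ({z, p, x, x', y, q} : Set V) ↔
      v = z ∨ v = p ∨ v = x ∨ v = x' ∨ v = y ∨ v = q := by simp
  generalize ({z, p, x, x', y, q} : Set V) = U at hU
  have hq'U : q' ∉ U := by simp [hU, Ne.symm zq', Ne.symm pq', Ne.symm xq', Ne.symm x'q',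
    Ne.symm yq', Ne.symm qq']
  have hy'U : y' ∉ U := by simp [hU, Ne.symm zy', Ne.symm py', Ne.symm xy', Ne.symm x'y',
    Ne.symm yy', y'q]
  have heU : e ∉ U := by simp [hU, Ne.symm ze, Ne.symm pe, Ne.symm xe, Ne.symm x'e,
    Ne.symm ye, Ne.symm qe]
  have hx'q' : ¬ G.Adj x' q' := fun hn => by
    rcases (h.right q').1 hn with e₁ | e₁
    · exact zq' e₁.symm
    · exact (h.disjoint q' e₁).2.2.2.2.2.2 rfl
  have hqq' : ¬ G.Adj q q' := fun hn => by
    rcases (h.outer q').1 hn with e₁ | e₁ | e₁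
    exacts [xq' e₁.symm, yq' e₁.symm, q'e e₁]
  have he'U : e' ∉ U := by
    have := (h' e').2 (by simp)
    intro hn
    obtain rfl | rfl | rfl | rfl | rfl | rfl := (hU e').1 hn
    · rcases (h.centre q').1 this.symm with e₁ | e₁ | e₁
      exacts [pq' e₁.symm, xq' e₁.symm, x'q' e₁.symm]
    · exact zq' ((h.leaf q').1 this.symm).symm
    · exact hx rfl
    · exact hx'q' this.symm
    · exact hy rfl
    · exact hqq' this.symm
  have hzx := (h.centre x).2 (by simp)
  have hy'w : ∀ w, G.Adj y' w → w ∉ U := fun w hw hwU => by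
    have := h.disjoint w hw
    have := (hU w).1 hwU
    tauto
  obtain ⟨d, hd⟩ := hG.exists_good_of_not_attached (a := z) (b := x) ((hU z).2 (.inl rfl))
    hzx (hG.no_attached_wide_flag h (fun v hv => by have := (hU v).1 hv; tauto)
      (by simp [hU]) (by simp [hU]) (by simp [hU]) (by simp [hU]) (by simp [hU])
      (fun v w hv hw hvU hwU => by
        rcases (h' v).1 hv with rfl | rfl | rfl
        · simp [hU] at hvU
        · simp [hU] at hvU
        · rcases (h' w).1 hw with rfl | rfl | rfl
          · simp [hU] at hwU
          · simp [hU] at hwU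
          · rfl) (fun hn => absurd hn hq'U))
  obtain ⟨c, hc, cz, cp, cx, cx', cy, cq⟩ : ∃ c : V → Bool, (∀ v, v ∉ U → c v = d v) ∧
      c z = (!d y') ∧ c p = d y' ∧ c x = d y' ∧ c x' = d y' ∧ c y = d y' ∧ c q = !d y' := by
    refine ⟨fun v => if v = z ∨ v = q then !d y' else if v ∈ U then d y' else d v,
      fun v hv => ?_, ?_, ?_, ?_, ?_, ?_, ?_⟩
    · have := hU v
      grind
    all_goals grind
  have cy' := hc y' hy'U
  have hgood := hd.recolour hc
  clear hd hc
  generalize d y' = m at *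
  obtain ⟨w₀, hw₀, hw₀U, hw₀c⟩ : ∃ w, G.Adj y' w ∧ w ∉ U ∧ c w = !m := by
    obtain ⟨w, hw⟩ := h.flag_right
    obtain ⟨w', hw', hc'⟩ := hgood.dom y' w ⟨hw, hy'U, hy'w w hw⟩
    refine ⟨w', hw'.1, hw'.2.2, ?_⟩
    rw [cy'] at hc'
    exact Bool.eq_not.2 hc'
  -- vertices outside `U` with the same neighbours outside `U` agree on `x'`
  have hx'y' : ∀ u, u ∉ U → G.Adj u x' → G.Adj u y' := fun u hu hn =>
    (((h.right u).1 hn.symm).resolve_left fun e => hu ((hU u).2 (.inl e))).symm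
  have hx'iff : ∀ u v, u ∉ U → v ∉ U → (∀ w, w ∉ U → (G.Adj u w ↔ G.Adj v w)) →
      (G.Adj u x' ↔ G.Adj v x') := fun u v hu hv hW => by
    rw [G.adj_comm u, G.adj_comm v, h.right, h.right, G.adj_comm y', G.adj_comm y', hW y' hy'U]
    have : u ≠ z := fun e => hu ((hU u).2 (.inl e))
    have : v ≠ z := fun e => hv ((hU v).2 (.inl e))
    simp [*]
  have hz : ∀ u, u ∉ U → ¬ G.Adj u z := fun u hu hn => hu (by
    rcases (h.centre u).1 hn.symm with rfl | rfl | rfl <;> simp [hU])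
  have hp : ∀ u, u ∉ U → ¬ G.Adj u p := fun u hu hn => hu (by
    simp [hU, (h.leaf u).1 hn.symm])
  have hxq' : ∀ u, u ∉ U → G.Adj u x → u = q' := fun u hu hn => by
    by_contra hne
    have := (h.left u).1 hn.symm
    simp only [hne, or_false] at this
    exact hu ((hU u).2 (by tauto))
  have hyq' : ∀ u, u ∉ U → G.Adj u y → u = q' := fun u hu hn => by
    by_contra hne
    have := (h.flag_left u).1 hn.symm
    simp only [hne, or_false] at this
    exact hu ((hU u).2 (by tauto))
  have hqe : ∀ u, u ∉ U → G.Adj u q → u = e := fun u hu hn => by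
    by_contra hne
    have := (h.outer u).1 hn.symm
    simp only [hne, or_false] at this
    exact hu ((hU u).2 (by tauto))
  have heW : ∃ w, G.Adj e w ∧ w ∉ U := by
    obtain ⟨v, hv, hvq⟩ := h.outer_nonleaf
    by_contra hn
    push Not at hn
    obtain rfl | rfl | rfl | rfl | rfl | rfl := (hU v).1 (hn v hv)
    · exact hz e heU hv
    · exact hp e heU hv
    · exact (Ne.symm q'e) (hxq' e heU hv)
    · exact hy'U (hn y' (hx'y' e heU hv))
    · exact (Ne.symm q'e) (hyq' e heU hv)
    · exact hvq rfl
  have hq'sep : ∀ v, v ∉ U → c q' = c v → v ≠ q' → (∀ w, w ∉ U → (G.Adj q' w ↔ G.Adj v w)) →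
      ∃ w ∈ U, ¬ (G.Adj q' w ↔ G.Adj v w) ∧ c w ≠ c q' := by
    intro v hv hcol hne hW
    by_contra hn
    push Not at hn
    have hcq' : c q' = m := by
      rw [← cx]
      exact (hn x (by simp [hU]) (.inl ⟨(h' x).2 (by simp), fun hi => hne (hxq' v hv hi)⟩)).symm
    have hvq : ¬ G.Adj v q := fun hvq => by
      have := hn q (by simp [hU]) (.inr ⟨fun hi => hqq' hi.symm, hvq⟩)
      simp [cq, hcq'] at this
    have hvx' : ¬ G.Adj v x' := fun hvx' => hx'q' ((hx'iff q' v hq'U hv hW).2 hvx').symm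
    have hvw : ∀ w, G.Adj v w → w ∉ U := fun w hw hwU => by
      obtain rfl | rfl | rfl | rfl | rfl | rfl := (hU w).1 hwU
      · exact hz v hv hw
      · exact hp v hv hw
      · exact hne (hxq' v hv hw)
      · exact hvx' hw
      · exact hne (hyq' v hv hw)
      · exact hvq hw
    have hq'e' : G.Adj q' e' := (h' e').2 (by simp)
    obtain ⟨x₁, y₁, x₂, y₂, hc, -, -, -, h₁, h₂⟩ := hG.leaf_support (z := e') (p := v) fun w =>
      ⟨fun hw => by
        rcases (h' w).1 ((hW w (hvw w hw)).2 hw) with rfl | rfl | e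
        · exact absurd (by simp [hU]) (hvw w hw)
        · exact absurd (by simp [hU]) (hvw w hw)
        · exact e, by rintro rfl; exact (hW w he'U).1 hq'e'⟩
    obtain ⟨s, hs⟩ : ∃ s, IsFlag G e' q' s := by
      rcases (hc q').1 hq'e'.symm with rfl | rfl | rfl
      exacts [absurd rfl hne, ⟨y₁, h₁⟩, ⟨y₂, h₂⟩]
    have hsy := (h.flag_left s).1 ((hs.iff y hy.symm).1 ((h' y).2 (by simp))).symm
    rcases hsy with rfl | rfl
    · have := (h' e).1 ((hs.iff e he.symm).2 ((h.outer e).2 (by simp)))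
      simp [(Ne.symm xe), (Ne.symm ye), he.symm] at this
    · exact hs.ne rfl
  refine hG.bad c (hgood.extend ?_ ?_ ?_ ?_)
  · intro u hu _ _
    obtain rfl | rfl | rfl | rfl | rfl | rfl := (hU u).1 hu
    · exact ⟨p, (h.centre p).2 (by simp), by simp [cp, cz]⟩
    · exact ⟨z, (h.leaf z).2 rfl, by simp [cp, cz]⟩
    · exact ⟨z, hzx.symm, by simp [cx, cz]⟩
    · exact ⟨z, (h.right z).2 (by simp), by simp [cx', cz]⟩
    · exact ⟨q, (h.flag_left q).2 (by simp), by simp [cy, cq]⟩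
    · exact ⟨x, (h.outer x).2 (by simp), by simp [cx, cq]⟩
  · intro u hu w huw hn
    exfalso
    obtain rfl | rfl | rfl | rfl | rfl | rfl := (hU w).1 (hn w huw)
    · exact hz u hu huw
    · exact hp u hu huw
    · obtain rfl := hxq' u hu huw
      exact he'U (hn e' ((h' e').2 (by simp)))
    · exact hy'U (hn y' (hx'y' u hu huw))
    · obtain rfl := hyq' u hu huw
      exact he'U (hn e' ((h' e').2 (by simp)))
    · obtain rfl := hqe u hu huw
      obtain ⟨v, hv, hvU⟩ := heW
      exact hvU (hn v hv)
  · intro u hu v hv huv hW t ht hut hvt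
    obtain rfl | rfl | rfl | rfl | rfl | rfl := (hU t).1 ht
    · exact absurd hut (hz u hu)
    · exact absurd hut (hp u hu)
    · obtain rfl := hxq' u hu hut
      exact hq'sep v hv huv (by rintro rfl; exact hvt hut) hW
    · exact absurd ((hx'iff u v hu hv hW).1 hut) hvt
    · obtain rfl := hyq' u hu hut
      exact hq'sep v hv huv (by rintro rfl; exact hvt hut) hW
    · obtain rfl := hqe u hu hut
      by_contra hn
      push Not at hn
      have hcu := hn t ht (by simp [hut, hvt])
      rw [cq] at hcu
      have hvq' : v ≠ q' := by
        rintro rfl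
        have := hn x (by simp [hU]) (.inr ⟨fun hi => (Ne.symm q'e) (hxq' u hu hi), (h' x).2 (by simp)⟩)
        simp [cx, ← hcu] at this
      obtain ⟨w₁, hw₁, hw₁U⟩ := heW
      refine h.not_flag u v ⟨hut, hvt, ⟨w₁, (hW w₁ hw₁U).1 hw₁⟩, fun w hw => ?_⟩
      by_cases hwU : w ∈ U
      · obtain rfl | rfl | rfl | rfl | rfl | rfl := (hU w).1 hwU
        · exact iff_of_false (hz u hu) (hz v hv)
        · exact iff_of_false (hp u hu) (hp v hv)
        · exact iff_of_false (fun hn => (Ne.symm q'e) (hxq' u hu hn)) (fun hn => hvq' (hxq' v hv hn))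
        · exact hx'iff u v hu hv hW
        · exact iff_of_false (fun hn => (Ne.symm q'e) (hyq' u hu hn)) (fun hn => hvq' (hyq' v hv hn))
        · exact absurd rfl hw
      · exact hW w hwU
  · have hpq : ¬ G.Adj p q := fun hn => by
      exact (Ne.symm zq) ((h.leaf q).1 hn)
    have hpw₀ : ¬ G.Adj p w₀ := fun hn => hw₀U ((hU w₀).2 (.inl ((h.leaf w₀).1 hn)))
    have hx'q : ¬ G.Adj x' q := fun hn => by
      rcases (h.right q).1 hn with e₁ | e₁
      · exact (Ne.symm zq) e₁
      · exact (h.disjoint q e₁).2.2.2.2.2.1 rfl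
    have hxq : G.Adj x q := (h.left q).2 (by simp)
    have hx'w₀ : G.Adj x' w₀ := (h.right w₀).2 (.inr hw₀)
    intro u hu v hvu hcol hs _ _ _
    obtain rfl | rfl | rfl | rfl | rfl | rfl := (hU u).1 hu
    · exact absurd ((h.leaf v).1 ((hs p (by simp [cz, cp])).1 ((h.centre p).2 (by simp))).symm) hvu
    · rcases (h.centre v).1 ((hs z (by simp [cz, cp])).1 ((h.leaf z).2 rfl)).symm with
        rfl | rfl | rfl
      · exact absurd rfl hvu
      · exact absurd ((hs q (by simp [cq, cp])).2 hxq) hpq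
      · exact absurd ((hs w₀ (by simp [hw₀c, cp])).2 hx'w₀) hpw₀
    · rcases (h.centre v).1 ((hs z (by simp [cz, cx])).1 hzx.symm).symm with rfl | rfl | rfl
      · exact absurd ((hs q (by simp [cq, cx])).1 hxq) hpq
      · exact absurd rfl hvu
      · exact absurd ((hs q (by simp [cq, cx])).1 hxq) hx'q
    · rcases (h.centre v).1 ((hs z (by simp [cz, cx'])).1 ((h.right z).2 (by simp))).symm with
        rfl | rfl | rfl
      · exact absurd ((hs w₀ (by simp [hw₀c, cx'])).1 hx'w₀) hpw₀
      · exact absurd ((hs q (by simp [cq, cx'])).2 hxq) hx'q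
      · exact absurd rfl hvu
    · rcases (h.outer v).1 ((hs q (by simp [cy, cq])).1 ((h.flag_left q).2 (by simp))).symm with
        rfl | rfl | rfl
      · rcases (h.flag_left z).1 ((hs z (by simp [cy, cz])).2 hzx.symm) with e₁ | e₁
        exacts [absurd e₁.symm (Ne.symm zq), absurd e₁.symm (Ne.symm zq')]
      · exact absurd rfl hvu
      · obtain ⟨w₁, hw₁, hw₁U⟩ := heW
        obtain ⟨w, ⟨hw, -, hwU⟩, hwc⟩ := hgood.dom v w₁ ⟨hw₁, heU, hw₁U⟩
        rcases (h.flag_left w).1 ((hs w (by rwa [← hcol])).2 hw) with rfl | rfl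
        · exact absurd ((hU w).2 (by simp)) hwU
        · rcases (h' v).1 hw.symm with e₁ | e₁ | e₁
          exacts [absurd e₁ (Ne.symm xe), absurd e₁ (Ne.symm ye), absurd e₁.symm he]
    · rcases (h.flag_left v).1 ((hs y (by simp [cy, cq])).1 ((h.outer y).2 (by simp))).symm with
        rfl | rfl
      · exact absurd rfl hvu
      · obtain ⟨w, ⟨hw, -, hwU⟩, hwc⟩ := hgood.dom v e' ⟨(h' e').2 (by simp), hq'U, he'U⟩
        have hwx : w ≠ x := fun e => hwU ((hU w).2 (by simp [e]))
        have hwy : w ≠ y := fun e => hwU ((hU w).2 (by simp [e]))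
        have h₁ : w = e' := by simpa [hwx, hwy] using (h' w).1 hw
        have h₂ : w = e := by simpa [hwx, hwy] using (h.outer w).1 ((hs w (by rwa [← hcol])).2 hw)
        exact absurd (h₁.symm.trans h₂) he

theorem MinimalBad.no_wide_flag_of_inner (hG : MinimalBad G) {z p x x' y y' q q' e : V}
    (h : IsWideFlag G z p x x' y y' q q' e) (h' : ∀ w, G.Adj q' w ↔ w = x ∨ w = y) : False := by
  classical
  have hnd := h.nodup
  simp only [List.nodup_cons, List.mem_cons, List.not_mem_nil, or_false, not_or, not_false_eq_true,
    List.nodup_nil, and_true] at hnd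
  obtain ⟨⟨zp, zx, zx', zy, zy', zq, zq', ze⟩, ⟨px, px', py, py', pq, pq', pe⟩,
    ⟨xx', xy, xy', xq, xq', xe⟩, ⟨x'y, x'y', x'q, x'q', x'e⟩, ⟨yy', yq, yq', ye⟩,
    ⟨y'q, y'q', y'e⟩, ⟨qq', qe⟩, q'e⟩ := hnd
  have hU : ∀ v, v ∈ ({z, p, x, x', y, q, q'} : Set V) ↔
      v = z ∨ v = p ∨ v = x ∨ v = x' ∨ v = y ∨ v = q ∨ v = q' := by simp
  generalize ({z, p, x, x', y, q, q'} : Set V) = U at hU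
  have hy'U : y' ∉ U := by simp [hU, Ne.symm zy', Ne.symm py', Ne.symm xy', Ne.symm x'y',
    Ne.symm yy', y'q, y'q']
  have heU : e ∉ U := by simp [hU, Ne.symm ze, Ne.symm pe, Ne.symm xe, Ne.symm x'e,
    Ne.symm ye, Ne.symm qe, Ne.symm q'e]
  have hzx := (h.centre x).2 (by simp)
  have hy'w : ∀ w, G.Adj y' w → w ∉ U := fun w hw hwU => by
    have := h.disjoint w hw
    have := (hU w).1 hwU
    tauto
  obtain ⟨d, hd⟩ := hG.exists_good_of_not_attached (a := z) (b := x) ((hU z).2 (.inl rfl))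
    hzx (hG.no_attached_wide_flag h (fun v hv => (hU v).1 hv)
      (by simp [hU]) (by simp [hU]) (by simp [hU]) (by simp [hU]) (by simp [hU])
      (fun v w hv _ hvU _ => by rcases (h' v).1 hv with rfl | rfl <;> simp [hU] at hvU)
      (fun _ w hw => by rcases (h' w).1 hw with rfl | rfl <;> simp [hU]))
  obtain ⟨c, hc, cz, cp, cx, cx', cy, cq, cq'⟩ : ∃ c : V → Bool, (∀ v, v ∉ U → c v = d v) ∧
      c z = (!d y') ∧ c p = d y' ∧ c x = d y' ∧ c x' = d y' ∧ c y = (!d y') ∧ c q = (!d y') ∧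
      c q' = d y' := by
    refine ⟨fun v => if v = z ∨ v = q ∨ v = y then !d y' else if v ∈ U then d y' else d v,
      fun v hv => ?_, ?_, ?_, ?_, ?_, ?_, ?_, ?_⟩
    · have := hU v
      grind
    all_goals grind
  have cy' := hc y' hy'U
  have hgood := hd.recolour hc
  clear hd hc
  generalize d y' = m at *
  obtain ⟨w₀, hw₀, hw₀U, hw₀c⟩ : ∃ w, G.Adj y' w ∧ w ∉ U ∧ c w = !m := by
    obtain ⟨w, hw⟩ := h.flag_right
    obtain ⟨w', hw', hc'⟩ := hgood.dom y' w ⟨hw, hy'U, hy'w w hw⟩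
    refine ⟨w', hw'.1, hw'.2.2, ?_⟩
    rw [cy'] at hc'
    exact Bool.eq_not.2 hc'
  have hx'y' : ∀ u, u ∉ U → G.Adj u x' → G.Adj u y' := fun u hu hn =>
    (((h.right u).1 hn.symm).resolve_left fun e => hu ((hU u).2 (.inl e))).symm
  have hx'iff : ∀ u v, u ∉ U → v ∉ U → (∀ w, w ∉ U → (G.Adj u w ↔ G.Adj v w)) →
      (G.Adj u x' ↔ G.Adj v x') := fun u v hu hv hW => by
    rw [G.adj_comm u, G.adj_comm v, h.right, h.right, G.adj_comm y', G.adj_comm y', hW y' hy'U]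
    have : u ≠ z := fun e => hu ((hU u).2 (.inl e))
    have : v ≠ z := fun e => hv ((hU v).2 (.inl e))
    simp [*]
  have hz : ∀ u, u ∉ U → ¬ G.Adj u z := fun u hu hn => hu (by
    rcases (h.centre u).1 hn.symm with rfl | rfl | rfl <;> simp [hU])
  have hp : ∀ u, u ∉ U → ¬ G.Adj u p := fun u hu hn => hu (by
    simp [hU, (h.leaf u).1 hn.symm])
  have hx : ∀ u, u ∉ U → ¬ G.Adj u x := fun u hu hn => hu (by
    rcases (h.left u).1 hn.symm with rfl | rfl | rfl <;> simp [hU])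
  have hy : ∀ u, u ∉ U → ¬ G.Adj u y := fun u hu hn => hu (by
    rcases (h.flag_left u).1 hn.symm with rfl | rfl <;> simp [hU])
  have hq' : ∀ u, u ∉ U → ¬ G.Adj u q' := fun u hu hn => hu (by
    rcases (h' u).1 hn.symm with rfl | rfl <;> simp [hU])
  have hqe : ∀ u, u ∉ U → G.Adj u q → u = e := fun u hu hn => by
    by_contra hne
    have := (h.outer u).1 hn.symm
    simp only [hne, or_false] at this
    exact hu ((hU u).2 (by tauto))
  have heW : ∃ w, G.Adj e w ∧ w ∉ U := by
    obtain ⟨v, hv, hvq⟩ := h.outer_nonleaf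
    by_contra hn
    push Not at hn
    obtain rfl | rfl | rfl | rfl | rfl | rfl | rfl := (hU v).1 (hn v hv)
    · exact hz e heU hv
    · exact hp e heU hv
    · exact hx e heU hv
    · exact hy'U (hn y' (hx'y' e heU hv))
    · exact hy e heU hv
    · exact hvq rfl
    · exact hq' e heU hv
  refine hG.bad c (hgood.extend ?_ ?_ ?_ ?_)
  · intro u hu _ _
    obtain rfl | rfl | rfl | rfl | rfl | rfl | rfl := (hU u).1 hu
    · exact ⟨p, (h.centre p).2 (by simp), by simp [cp, cz]⟩
    · exact ⟨z, (h.leaf z).2 rfl, by simp [cp, cz]⟩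
    · exact ⟨z, hzx.symm, by simp [cx, cz]⟩
    · exact ⟨z, (h.right z).2 (by simp), by simp [cx', cz]⟩
    · exact ⟨q', (h.flag_left q').2 (by simp), by simp [cy, cq']⟩
    · exact ⟨x, (h.outer x).2 (by simp), by simp [cx, cq]⟩
    · exact ⟨y, (h' y).2 (by simp), by simp [cy, cq']⟩
  · intro u hu w huw hn
    exfalso
    obtain rfl | rfl | rfl | rfl | rfl | rfl | rfl := (hU w).1 (hn w huw)
    · exact hz u hu huw
    · exact hp u hu huw
    · exact hx u hu huw
    · exact hy'U (hn y' (hx'y' u hu huw))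
    · exact hy u hu huw
    · obtain rfl := hqe u hu huw
      obtain ⟨v, hv, hvU⟩ := heW
      exact hvU (hn v hv)
    · exact hq' u hu huw
  · intro u hu v hv huv hW t ht hut hvt
    obtain rfl | rfl | rfl | rfl | rfl | rfl | rfl := (hU t).1 ht
    · exact absurd hut (hz u hu)
    · exact absurd hut (hp u hu)
    · exact absurd hut (hx u hu)
    · exact absurd ((hx'iff u v hu hv hW).1 hut) hvt
    · exact absurd hut (hy u hu)
    · obtain rfl := hqe u hu hut
      obtain ⟨w₁, hw₁, hw₁U⟩ := heW
      refine absurd ⟨hut, hvt, ⟨w₁, (hW w₁ hw₁U).1 hw₁⟩, fun w hw => ?_⟩ (h.not_flag u v)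
      by_cases hwU : w ∈ U
      · obtain rfl | rfl | rfl | rfl | rfl | rfl | rfl := (hU w).1 hwU
        · exact iff_of_false (hz u hu) (hz v hv)
        · exact iff_of_false (hp u hu) (hp v hv)
        · exact iff_of_false (hx u hu) (hx v hv)
        · exact hx'iff u v hu hv hW
        · exact iff_of_false (hy u hu) (hy v hv)
        · exact absurd rfl hw
        · exact iff_of_false (hq' u hu) (hq' v hv)
      · exact hW w hwU
    · exact absurd hut (hq' u hu)
  · have hpq : ¬ G.Adj p q := fun hn => (Ne.symm zq) ((h.leaf q).1 hn)
    have hpw₀ : ¬ G.Adj p w₀ := fun hn => hw₀U ((hU w₀).2 (.inl ((h.leaf w₀).1 hn)))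
    have hx'q : ¬ G.Adj x' q := fun hn => by
      rcases (h.right q).1 hn with e₁ | e₁
      · exact (Ne.symm zq) e₁
      · exact (h.disjoint q e₁).2.2.2.2.2.1 rfl
    have hxq : G.Adj x q := (h.left q).2 (by simp)
    have hx'w₀ : G.Adj x' w₀ := (h.right w₀).2 (.inr hw₀)
    intro u hu v hvu hcol hs _ _ _
    obtain rfl | rfl | rfl | rfl | rfl | rfl | rfl := (hU u).1 hu
    · exact absurd ((h.leaf v).1 ((hs p (by simp [cz, cp])).1 ((h.centre p).2 (by simp))).symm) hvu
    · rcases (h.centre v).1 ((hs z (by simp [cz, cp])).1 ((h.leaf z).2 rfl)).symm with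
        rfl | rfl | rfl
      · exact absurd rfl hvu
      · exact absurd ((hs q (by simp [cq, cp])).2 hxq) hpq
      · exact absurd ((hs w₀ (by simp [hw₀c, cp])).2 hx'w₀) hpw₀
    · rcases (h.centre v).1 ((hs z (by simp [cz, cx])).1 hzx.symm).symm with rfl | rfl | rfl
      · exact absurd ((hs q (by simp [cq, cx])).1 hxq) hpq
      · exact absurd rfl hvu
      · exact absurd ((hs q (by simp [cq, cx])).1 hxq) hx'q
    · rcases (h.centre v).1 ((hs z (by simp [cz, cx'])).1 ((h.right z).2 (by simp))).symm with
        rfl | rfl | rfl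
      · exact absurd ((hs w₀ (by simp [hw₀c, cx'])).1 hx'w₀) hpw₀
      · exact absurd ((hs q (by simp [cq, cx'])).2 hxq) hx'q
      · exact absurd rfl hvu
    · rcases (h' v).1 ((hs q' (by simp [cy, cq'])).1 ((h.flag_left q').2 (by simp))).symm with
        rfl | rfl
      · simp [cx, cy] at hcol
      · exact absurd rfl hvu
    · rcases (h.left v).1 ((hs x (by simp [cx, cq])).1 hxq.symm).symm with rfl | rfl | rfl
      · exact absurd ((hs p (by simp [cp, cq])).2 ((h.centre p).2 (by simp))).symm hpq
      · exact absurd rfl hvu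
      · simp [cq, cq'] at hcol
    · rcases (h.flag_left v).1 ((hs y (by simp [cy, cq'])).1 ((h' y).2 (by simp))).symm with
        rfl | rfl
      · simp [cq, cq'] at hcol
      · exact absurd rfl hvu

theorem MinimalBad.exists_flag_of_ne_leaf (hG : MinimalBad G) {z p x : V}
    (hp : ∀ w, G.Adj p w ↔ w = z) (hx : G.Adj z x) (hxp : x ≠ p) : ∃ y, IsFlag G z x y := by
  obtain ⟨x₁, y₁, x₂, y₂, hc, -, -, -, h₁, h₂⟩ := hG.leaf_support hp
  rcases (hc x).1 hx with rfl | rfl | rfl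
  exacts [absurd rfl hxp, ⟨y₁, h₁⟩, ⟨y₂, h₂⟩]

theorem MinimalBad.not_flag_outer (hG : MinimalBad G) {z p x x' y y' q q' : V}
    (hp : ∀ w, G.Adj p w ↔ w = z) (hz : ∀ w, G.Adj z w ↔ w = p ∨ w = x ∨ w = x')
    (hx'x : x' ≠ x) (h : IsFlag G z x y) (h' : IsFlag G z x' y') (hq : G.Adj y q)
    (hq' : G.Adj y q') (hqq' : q ≠ q') (s : V) : ¬ IsFlag G q x s := by
  intro hs
  have hzq : z ≠ q := fun e => h.right (e ▸ hq)
  have hzq' : q' ≠ z := fun e => h.right (e ▸ hq')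
  have hxq' := (h.iff q' hzq').2 hq'
  rcases (hz s).1 ((hs.iff z hzq).1 h.left).symm with rfl | rfl | rfl
  · exact hzq' ((hp q').1 ((hs.iff q' hqq'.symm).1 hxq'))
  · exact hs.ne rfl
  · exact hG.flag_disjoint h h' hx'x.symm hzq' hxq' ((hs.iff q' hqq'.symm).1 hxq')

theorem MinimalBad.isWideFlag (hG : MinimalBad G) {z p x x' y y' q q' e : V}
    (hp : ∀ w, G.Adj p w ↔ w = z) (hz : ∀ w, G.Adj z w ↔ w = p ∨ w = x ∨ w = x')
    (hpx : p ≠ x) (hpx' : p ≠ x') (hx'x : x' ≠ x) (h : IsFlag G z x y) (h' : IsFlag G z x' y')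
    (hyq : G.Adj y q) (hyq' : G.Adj y q') (hqq' : q ≠ q')
    (hq : ∀ w, G.Adj q w ↔ w = x ∨ w = y ∨ w = e) (hex : e ≠ x) (hey : e ≠ y) :
    IsWideFlag G z p x x' y y' q q' e := by
  have hzq : q ≠ z := fun e => h.right (e ▸ hyq)
  have hzq' : q' ≠ z := fun e => h.right (e ▸ hyq')
  have hxq := (h.iff q hzq).2 hyq
  have hxq' := (h.iff q' hzq').2 hyq'
  have hxx' : ¬ G.Adj x x' := hG.no_house h h'
  have hyx' : ¬ G.Adj y x' := fun hn => hxx' ((h.iff x' h'.left.ne).2 hn)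
  have hx'q := hG.flag_disjoint h h' hx'x.symm hzq hxq
  have hx'q' := hG.flag_disjoint h h' hx'x.symm hzq' hxq'
  have hpq : ∀ w, G.Adj y w → w ≠ p := fun w hw hn =>
    h.ne_centre ((hp y).1 (hn ▸ hw.symm))
  have hx'w : ∀ w, G.Adj y' w → G.Adj x' w := fun w hw =>
    (h'.iff w fun hn => h'.right (hn ▸ hw)).2 hw
  have hleft : ∀ w, G.Adj x w ↔ w = z ∨ w = q ∨ w = q' := fun w =>
    ⟨fun hw => by have := hG.subcubic x z q q' w h.left hxq hxq' hw; grind, by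
      rintro (rfl | rfl | rfl); exacts [h.left, hxq, hxq']⟩
  have hflag : ∀ w, G.Adj y w ↔ w = q ∨ w = q' := fun w =>
    ⟨fun hw => by
      have hwz : w ≠ z := fun e => h.right (e ▸ hw)
      exact ((hleft w).1 ((h.iff w hwz).2 hw)).resolve_left hwz, by
      rintro (rfl | rfl); exacts [hyq, hyq']⟩
  have hnq := hG.not_flag_outer hp hz hx'x h h' hyq hyq' hqq'
  have hleaf : ∀ l, (∀ w, G.Adj l w ↔ w = q) → False := fun l hl => by
    obtain ⟨s, hs⟩ := hG.exists_flag_of_ne_leaf hl hxq.symm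
      (fun e => hzq ((hl z).1 (e ▸ h.left)).symm)
    exact hnq s hs
  have hqe := (hq e).2 (.inr (.inr rfl))
  have hq'e : q' ≠ e := fun e => hG.no_apex_triangle hflag (e ▸ hqe)
  have hpz := (hp z).2 rfl
  have hpe : p ≠ e := fun hn => hzq ((hp q).1 (hn ▸ hqe.symm))
  have hze : z ≠ e := fun hn => by
    rcases (hz q).1 (hn ▸ hqe.symm) with e₁ | e₁ | e₁
    exacts [hpq q hyq e₁, hxq.ne e₁.symm, hyx' (e₁ ▸ hyq)]
  refine ⟨hp, hz, hleft, hflag, fun w => ?_, h'.nonempty, hq, ?_, fun w hw => ?_, fun u v hn => ?_, ?_⟩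
  · by_cases hw : w = z
    · simp [hw, h'.left]
    · simp [hw, h'.iff]
  · by_contra hn
    push Not at hn
    exact hleaf e fun w => ⟨hn w, fun hw => hw ▸ hqe.symm⟩
  · have := hx'w w hw
    refine ⟨?_, ?_, ?_, ?_, ?_, ?_, ?_⟩ <;> rintro rfl
    · exact h'.right hw
    · exact h'.left.ne ((hp _).1 this.symm)
    · exact hxx' this.symm
    · exact this.ne rfl
    · exact hyx' this.symm
    · exact hx'q this
    · exact hx'q' this
  · obtain ⟨l, -, -, -, hl, -⟩ := hG.flag_centre hn
    exact hleaf l hl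
  · have hy'z := h'.ne_centre
    have hpy : p ≠ y := fun hn => hzq ((hp q).1 (hn ▸ hyq))
    have hpy' : p ≠ y' := fun hn => h'.right (hn ▸ hpz)
    have hxy' : x ≠ y' := fun hn => h'.right (hn ▸ h.left)
    have hx'y : x' ≠ y := fun hn => h.right (hn ▸ h'.left)
    have hx'e : x' ≠ e := fun hn => hx'q (hn ▸ hqe.symm)
    have hyy' : y ≠ y' := fun hn => hx'q (hx'w q (hn ▸ hyq))
    have hy'q : y' ≠ q := fun hn => hxx' (hx'w x (hn ▸ hxq.symm)).symm
    have hy'q' : y' ≠ q' := fun hn => hxx' (hx'w x (hn ▸ hxq'.symm)).symm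
    have hy'e : y' ≠ e := fun hn => hx'q (hx'w q (hn ▸ hqe.symm))
    have hx'q₀ : x' ≠ q := fun hn => hyx' (hn ▸ hyq)
    have hx'q₁ : x' ≠ q' := fun hn => hyx' (hn ▸ hyq')
    simp only [List.nodup_cons, List.mem_cons, List.not_mem_nil, or_false, not_or,
      not_false_eq_true, List.nodup_nil, and_true]
    exact ⟨⟨hpz.ne.symm, h.left.ne.symm, h'.left.ne.symm, h.ne_centre.symm, hy'z.symm, hzq.symm,
      hzq'.symm, hze⟩, ⟨hpx, hpx', hpy, hpy', (hpq q hyq).symm, (hpq q' hyq').symm, hpe⟩,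
      ⟨hx'x.symm, h.ne.symm, hxy', hxq.ne, hxq'.ne, hex.symm⟩,
      ⟨hx'y, h'.ne.symm, hx'q₀, hx'q₁, hx'e⟩, ⟨hyy', hyq.ne, hyq'.ne, hey.symm⟩,
      ⟨hy'q, hy'q', hy'e⟩, ⟨hqq', hqe.ne⟩, hq'e⟩

/-- A flag at a vertex that supports a leaf is itself a leaf. -/
theorem MinimalBad.flag_leaf (hG : MinimalBad G) {z x y q q' : V} (h : IsFlag G z x y)
    (hyq : G.Adj y q) (hyq' : G.Adj y q') : q = q' := by
  by_contra hqq'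
  obtain ⟨p, x', y', hz, hp, hpx, hpx', hx'x, h'⟩ := hG.flag_centre h
  have hzq : q ≠ z := fun e => h.right (e ▸ hyq)
  have hzq' : q' ≠ z := fun e => h.right (e ▸ hyq')
  have hxq := (h.iff q hzq).2 hyq
  have hxq' := (h.iff q' hzq').2 hyq'
  obtain ⟨e, he⟩ := hG.exists_third hxq.symm hyq.symm h.ne.symm
  obtain ⟨e', he'⟩ := hG.exists_third hxq'.symm hyq'.symm h.ne.symm
  have key : ∀ {q q' e e' : V}, G.Adj y q → G.Adj y q' → q ≠ q' →
      (∀ w, G.Adj q w ↔ w = x ∨ w = y ∨ w = e) → (∀ w, G.Adj q' w ↔ w = x ∨ w = y ∨ w = e') →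
      e ≠ x → e ≠ y → False := by
    intro q q' e e' hyq hyq' hqq' he he' hex hey
    have hW := hG.isWideFlag hp hz hpx hpx' hx'x h h' hyq hyq' hqq' he hex hey
    by_cases he'x : e' = x ∨ e' = y
    · refine hG.no_wide_flag_of_inner hW fun w => ?_
      rw [he']
      grind
    · push Not at he'x
      refine hG.no_wide_flag_of_outer hW he' he'x.1 he'x.2 ?_
      rintro rfl
      exact hG.no_twins hqq' hyq.symm fun w => by rw [he, he']
  by_cases hex : e = x ∨ e = y
  · by_cases he'x : e' = x ∨ e' = y
    · exact hG.no_twins hqq' hyq.symm fun w => by rw [he, he']; grind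
    · push Not at he'x
      exact key hyq' hyq (Ne.symm hqq') he' he he'x.1 he'x.2
  · push Not at hex
    exact key hyq hyq' hqq' he he' hex.1 hex.2

/-- Colouring the supports of leaves differently from their neighbours would be proper, so there
are no leaves. -/
theorem MinimalBad.no_leaf (hG : MinimalBad G) {z p : V} (hp : ∀ w, G.Adj p w ↔ w = z) :
    False := by
  classical
  set L : Set V := {z | ∃ p, ∀ w, G.Adj p w ↔ w = z} with hL
  have hflag : ∀ z x y, IsFlag G z x y → ∃ q, q ∈ L ∧ ∀ w, G.Adj x w ↔ w = z ∨ w = q := by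
    intro z x y h
    obtain ⟨q, hq⟩ := h.nonempty
    have hy : ∀ w, G.Adj y w ↔ w = q := fun w =>
      ⟨fun hw => hG.flag_leaf h hw hq, fun e => e ▸ hq⟩
    refine ⟨q, ⟨y, hy⟩, fun w => ?_⟩
    by_cases hw : w = z
    · simp [hw, h.left]
    · rw [h.iff w hw, hy]; simp [hw]
  have hnbr : ∀ z ∈ L, ∀ x, G.Adj z x → x ∉ L ∧ ∀ w, G.Adj x w → w ∈ L := by
    rintro z ⟨p, hp⟩ x hx
    by_cases hxp : x = p
    · subst hxp
      refine ⟨?_, fun w hw => (hp w).1 hw ▸ ⟨x, hp⟩⟩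
      rintro ⟨p', hp'⟩
      obtain ⟨x₁, -, x₂, -, hc, -, -, hne, -⟩ := hG.leaf_support hp'
      exact hne (((hp x₂).1 ((hc x₂).2 (by simp))).trans ((hp x₁).1 ((hc x₁).2 (by simp))).symm)
    · obtain ⟨y, hy⟩ := hG.exists_flag_of_ne_leaf hp hx hxp
      obtain ⟨q, hq, hxq⟩ := hflag z x y hy
      refine ⟨?_, fun w hw => ?_⟩
      · rintro ⟨p', hp'⟩
        obtain ⟨x₁, -, x₂, -, hc, h₁, h₂, hne, -⟩ := hG.leaf_support hp'
        have := (hxq p').1 ((hc p').2 (by simp))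
        have := (hxq x₁).1 ((hc x₁).2 (by simp))
        have := (hxq x₂).1 ((hc x₂).2 (by simp))
        grind
      · rcases (hxq w).1 hw with rfl | rfl
        exacts [⟨p, hp⟩, hq]
  have hadj : ∀ z ∈ L, ∃ w, G.Adj z w := fun z ⟨p, hp⟩ => ⟨p, ((hp z).2 rfl).symm⟩
  refine hG.not_closed_proper (U := {v | v ∈ L ∨ ∃ z ∈ L, G.Adj z v}) (a := z) (b := p)
    (.inl ⟨p, hp⟩) ((hp z).2 rfl).symm ?_ ?_ (fun v => decide (v ∈ L)) ?_
  · rintro u (hu | ⟨z, hz, hzu⟩) w hw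
    · exact .inr ⟨u, hu, hw⟩
    · exact .inl ((hnbr z hz u hzu).2 w hw)
  · rintro u (hu | ⟨z, hz, hzu⟩)
    · exact hadj u hu
    · exact ⟨z, hzu.symm⟩
  · rintro u (hu | ⟨z, hz, hzu⟩) w hw
    · simp [hu, (hnbr u hu w hw).1]
    · simp [(hnbr z hz u hzu).1, (hnbr z hz u hzu).2 w hw]

theorem MinimalBad.no_flag (hG : MinimalBad G) {z x y : V} : ¬ IsFlag G z x y := fun h => by
  obtain ⟨p, -, -, -, hp, -⟩ := hG.flag_centre h
  exact hG.no_leaf hp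

theorem MinimalBad.domino_or_attached (hG : MinimalBad G) {z z' : V} (hz : G.Adj z z') :
    (∃ a b x y, IsDominoMiddle G z z' a b x y) ∨
      ∃ p q r y, IsAttachedTriangle G {z, z'} p q r y := by
  by_contra hn
  push Not at hn
  refine hG.edge (U := {z, z'}) (by simp) hz (fun v w hvz hvz' hvw => ?_) (fun _ _ => hG.no_flag)
    (fun _ _ => hG.no_flag) hn.2 hn.1
  by_contra hv
  push Not at hv
  have h : ∀ t, G.Adj v t → t = z ∨ t = z' := fun t ht => by have := hv t ht; tauto
  by_cases h₁ : G.Adj v z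
  · by_cases h₂ : G.Adj v z'
    · exact hG.no_apex_triangle (fun t => ⟨h t, by rintro (rfl | rfl) <;> assumption⟩) hz
    · exact hG.no_leaf (p := v) (z := z) fun t => by grind
  · exact hG.no_leaf (p := v) (z := z') fun t => by grind

theorem MinimalBad.no_double_attached (hG : MinimalBad G) {s s' p q r : V} (hs : G.Adj s s')
    (hsp' : s' ≠ p) (hsq' : s' ≠ q) (hpq : G.Adj p q) (hpr : G.Adj p r) (hqr : G.Adj q r)
    (hps : G.Adj p s) (hqs : G.Adj q s) (hrs : G.Adj r s') (hsr : s ≠ r) : False := by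
  have hN : ∀ {v a b d : V}, G.Adj v a → G.Adj v b → G.Adj v d → a ≠ b → a ≠ d → b ≠ d →
      ∀ w, G.Adj v w → w = a ∨ w = b ∨ w = d := fun ha hb hd _ _ _ w hw => by
    have := hG.subcubic _ _ _ _ w ha hb hd hw
    tauto
  have hp := hN hpq hpr hps hqr.ne hqs.ne hsr.symm
  have hq := hN hpq.symm hqr hqs hpr.ne hps.ne hsr.symm
  have hr := hN hpr.symm hqr.symm hrs hpq.ne hsp'.symm hsq'.symm
  have hs := hN hps.symm hqs.symm hs hpq.ne hsp'.symm hsq'.symm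
  rcases hG.domino_or_attached hpq with ⟨a, b, x, y, h⟩ | ⟨p₁, q₁, r₁, t, h⟩
  · have h₁ := h.ax.ne
    have h₂ := h.by'.ne
    rcases (h.left r).1 hpr with rfl | rfl | rfl
    · exact hqr.ne rfl
    · rcases (h.right r).1 hqr with rfl | rfl | rfl
      exacts [hpr.ne rfl, h₁ rfl, h.ay rfl]
    · rcases (h.right r).1 hqr with rfl | rfl | rfl
      exacts [hpr.ne rfl, h.bx rfl, h₂ rfl]
  · have h₁ := h.pq
    have h₂ := h.pr
    have h₃ := h.qr.ne
    have hp₁ := h.hp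
    have hq₁ := h.hq
    have hr₁ := h.hr
    have ht := h.hx
    have h₄ := h.px.symm
    simp only [Set.mem_insert_iff, Set.mem_singleton_iff, not_or] at hp₁ hq₁ hr₁ ht
    have : p₁ = r ∨ p₁ = s := by
      rcases ht with rfl | rfl
      · have := hp p₁ h₄; tauto
      · have := hq p₁ h₄; tauto
    rcases this with rfl | rfl
    · have := hr q₁ h₁
      have := hr r₁ h₂
      grind
    · have := hs q₁ h₁
      have := hs r₁ h₂
      grind

theorem MinimalBad.exists_domino (hG : MinimalBad G) {z z' : V} (hz : G.Adj z z') :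
    ∃ a b x y, IsDominoMiddle G z z' a b x y := by
  refine (hG.domino_or_attached hz).resolve_right ?_
  rintro ⟨p, q, r, t, h⟩
  have hp := h.hp
  have hq := h.hq
  have hr := h.hr
  have ht := h.hx
  have hpq := h.pq
  have hpr := h.pr
  have hqr := h.qr
  have hpt := h.px
  have hmid := h.mid
  have hright := h.right
  simp only [Set.mem_insert_iff, Set.mem_singleton_iff, not_or] at hp hq hr ht hmid hright
  have hq' : ∃ w, (w = z ∨ w = z') ∧ G.Adj q w := by
    by_contra hn
    push Not at hn
    exact hG.no_apex_triangle (x := q) (z := p) (z' := r) (fun w => ⟨fun hw => by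
      have := hmid w hw; have := hn w; tauto, by
      rintro (rfl | rfl); exacts [hpq.symm, hqr]⟩) hpr
  have hr' : ∃ w, (w = z ∨ w = z') ∧ G.Adj r w := by
    by_contra hn
    push Not at hn
    exact hG.no_apex_triangle (x := r) (z := p) (z' := q) (fun w => ⟨fun hw => by
      have := hright w hw; have := hn w; tauto, by
      rintro (rfl | rfl); exacts [hpr.symm, hqr.symm]⟩) hpq
  obtain ⟨t', ht', hqt⟩ := hq'
  obtain ⟨t'', ht'', hrt⟩ := hr'
  have hK := hG.noK4 p q r t hpq hpr hpt hqr
  have key : ∀ {a b d s s' : V}, G.Adj s s' → s' ≠ a → s' ≠ b → s ≠ d → G.Adj a b → G.Adj a d →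
      G.Adj b d → G.Adj a s → G.Adj b s → G.Adj d s' → False :=
    fun hs h₁ h₂ h₃ h₄ h₅ h₆ h₇ h₈ h₉ => hG.no_double_attached hs h₁ h₂ h₄ h₅ h₆ h₇ h₈ h₉ h₃
  have hst : ∀ {s s'}, (s = z ∨ s = z') → (s' = z ∨ s' = z') → s ≠ s' → G.Adj s s' := by
    rintro s s' (rfl | rfl) (rfl | rfl) hne
    exacts [absurd rfl hne, hz, hz.symm, absurd rfl hne]
  have hne : ∀ {v s}, (¬ v = z ∧ ¬ v = z') → (s = z ∨ s = z') → s ≠ v := by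
    rintro v s hv (rfl | rfl)
    exacts [fun e => hv.1 e.symm, fun e => hv.2 e.symm]
  by_cases e₁ : t = t'
  · subst e₁
    by_cases e₂ : t = t''
    · subst e₂
      exact hK hqt hrt
    · exact key (hst ht ht'' e₂) (hne hp ht'') (hne hq ht'') (hne hr ht) hpq hpr hqr hpt hqt hrt
  · by_cases e₂ : t = t''
    · subst e₂
      exact key (hst ht ht' e₁) (hne hp ht') (hne hr ht') (hne hq ht) hpr hpq hqr.symm hpt hrt hqt
    · obtain rfl : t' = t'' := by grind
      exact key (hst ht' ht (Ne.symm e₁)) (hne hq ht) (hne hr ht) (hne hp ht') hqr hpq.symm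
        hpr.symm hqt hrt hpt

/-- No component is bipartite with four vertices on each side. -/
theorem MinimalBad.no_bipartite_component (hG : MinimalBad G) {z x y p z' a b r : V}
    (hza : G.Adj z a) (hxr : G.Adj x r) (hyr : G.Adj y r) (hpr : G.Adj p r) (hzx : G.Adj z' x)
    (hax : G.Adj a x) (hby : G.Adj b y)
    (hdis : ∀ v, v = z ∨ v = x ∨ v = y ∨ v = p → ¬ (v = z' ∨ v = a ∨ v = b ∨ v = r))
    (hT : ∀ v, v = z ∨ v = x ∨ v = y ∨ v = p → ∀ w, G.Adj v w →
      w = z' ∨ w = a ∨ w = b ∨ w = r)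
    (hF : ∀ v, v = z' ∨ v = a ∨ v = b ∨ v = r → ∀ w, G.Adj v w →
      w = z ∨ w = x ∨ w = y ∨ w = p) : False := by
  classical
  refine hG.not_closed_proper (U := {v | (v = z ∨ v = x ∨ v = y ∨ v = p) ∨
    (v = z' ∨ v = a ∨ v = b ∨ v = r)}) (a := z) (b := a) (by simp) hza ?_ ?_
    (fun v => decide (v = z ∨ v = x ∨ v = y ∨ v = p)) ?_
  · rintro u (hu | hu) w hw
    exacts [.inr (hT u hu w hw), .inl (hF u hu w hw)]
  · rintro u ((rfl | rfl | rfl | rfl) | (rfl | rfl | rfl | rfl))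
    exacts [⟨_, hza⟩, ⟨_, hxr⟩, ⟨_, hyr⟩, ⟨_, hpr⟩, ⟨_, hzx⟩, ⟨_, hax⟩, ⟨_, hby⟩, ⟨_, hpr.symm⟩]
  · rintro u (hu | hu) w hw
    · have h₁ : ¬ (w = z ∨ w = x ∨ w = y ∨ w = p) := fun hn => hdis w hn (hT u hu w hw)
      simp only [decide_eq_true hu, decide_eq_false h₁]
      simp
    · have h₁ : ¬ (u = z ∨ u = x ∨ u = y ∨ u = p) := fun hn => hdis u hn hu
      simp only [decide_eq_true (hF u hu w hw), decide_eq_false h₁]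
      simp

theorem not_minimalBad (hG : MinimalBad G) : False := by
  classical
  by_cases hE : ∀ u v, ¬ G.Adj u v
  · exact hG.bad (fun _ => true) ⟨fun u w h => absurd h (hE u w), fun u v _ _ w =>
      iff_of_false (hE u w) (hE v w)⟩
  push Not at hE
  obtain ⟨z, z', hz⟩ := hE
  have hS : ∀ {u v a b x y : V}, (∀ w, G.Adj u w ↔ w = v ∨ w = a ∨ w = b) →
      (∀ w, G.Adj v w ↔ w = u ∨ w = x ∨ w = y) →
      G.Adj a x ∧ G.Adj b y ∨ G.Adj a y ∧ G.Adj b x := by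
    intro u v a b x y hu hv
    obtain ⟨a₁, b₁, x₁, y₁, h⟩ := hG.exists_domino ((hu v).2 (by simp))
    have h₁ := ((hu a₁).1 ((h.left a₁).2 (by simp))).resolve_left h.az
    have h₂ := ((hu b₁).1 ((h.left b₁).2 (by simp))).resolve_left h.bz
    have h₃ := ((hv x₁).1 ((h.right x₁).2 (by simp))).resolve_left h.xz
    have h₄ := ((hv y₁).1 ((h.right y₁).2 (by simp))).resolve_left h.yz
    have h₅ := h.ax
    have h₆ := h.by'
    have h₇ := h.ab
    have h₈ := h.xy
    rcases h₁ with rfl | rfl <;> rcases h₂ with rfl | rfl <;> rcases h₃ with rfl | rfl <;>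
      rcases h₄ with rfl | rfl <;> simp_all
  have hC : ∀ {v w w' : V}, G.Adj v w → G.Adj v w' → w ≠ w' →
      ∃ t, t ≠ w ∧ t ≠ w' ∧ ∀ s, G.Adj v s ↔ s = w ∨ s = w' ∨ s = t := by
    intro v w w' hw hw' hne
    obtain ⟨a₁, b₁, x₁, y₁, h⟩ := hG.exists_domino hw
    have h₁ := (h.left w').1 hw'
    have h₂ := h.left
    have h₃ := h.az
    have h₄ := h.bz
    have h₅ := h.ab
    rcases h₁ with rfl | rfl | rfl
    · exact absurd rfl hne
    · exact ⟨b₁, h₄, h₅.symm, h₂⟩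
    · exact ⟨a₁, h₃, h₅, fun s => by rw [h₂]; tauto⟩
  obtain ⟨a, b, x, y, h⟩ := hG.exists_domino hz
  have hz := h.left
  have hz' := h.right
  have hza := (hz a).2 (by simp)
  have hzb := (hz b).2 (by simp)
  have hzx := (hz' x).2 (by simp)
  have hzy := (hz' y).2 (by simp)
  have hax := h.ax
  have hby := h.by'
  obtain ⟨a', haz, hax', ha⟩ := hC hza.symm hax h.xz.symm
  obtain ⟨b', hbz, hby', hb⟩ := hC hzb.symm hby h.yz.symm
  obtain ⟨x', hxz, hxa', hx⟩ := hC hzx.symm hax.symm h.az.symm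
  obtain ⟨y', hyz, hyb', hy⟩ := hC hzy.symm hby.symm h.bz.symm
  -- a complete bipartite graph on six vertices has twins
  have htw : ¬ (G.Adj a y ∧ G.Adj b x) := fun ⟨hay, hbx⟩ => by
    have h₁ : y = a' := by have := (ha y).1 hay; have := h.yz; have := h.xy; tauto
    have h₂ : x = b' := by have := (hb x).1 hbx; have := h.xz; have := h.xy; tauto
    subst h₁ h₂
    exact hG.no_twins h.ab hax fun w => by rw [ha, hb]; tauto
  have hz₁ : ∀ w, G.Adj z w ↔ w = a ∨ w = z' ∨ w = b := fun w => by rw [hz]; tauto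
  have hz₂ : ∀ w, G.Adj z w ↔ w = b ∨ w = z' ∨ w = a := fun w => by rw [hz]; tauto
  have hay : ¬ G.Adj a y := fun hay => by
    refine htw ⟨hay, ?_⟩
    rcases hS hz₂ hb with ⟨-, h₁⟩ | ⟨h₁, -⟩
    · rcases (ha b').1 h₁ with e | e | e
      · exact absurd e hbz
      · exact (hb x).2 (by simp [e])
      · have := (ha y).1 hay
        have := h.yz
        have := h.xy
        grind
    · rcases (hz' b').1 h₁ with e | e | e
      · exact absurd e hbz
      · exact (hb x).2 (by simp [e])
      · exact absurd e hby'
  have hbx : ¬ G.Adj b x := fun hbx => by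
    refine htw ⟨?_, hbx⟩
    rcases hS hz₁ ha with ⟨-, h₁⟩ | ⟨h₁, -⟩
    · rcases (hb a').1 h₁ with e | e | e
      · exact absurd e haz
      · exact (ha y).2 (by simp [e])
      · have := (hb x).1 hbx
        have := h.xz
        have := h.xy
        grind
    · rcases (hz' a').1 h₁ with e | e | e
      · exact absurd e haz
      · exact absurd e hax'
      · exact (ha y).2 (by simp [e])
  have hz'₁ : ∀ w, G.Adj z' w ↔ w = x ∨ w = z ∨ w = y := fun w => by rw [hz']; tauto
  have hba' : G.Adj b a' := (hS hz₁ ha).elim (fun h => h.2) fun h => absurd h.2 hbx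
  have hyx' : G.Adj y x' := (hS hz'₁ hx).elim (fun h => h.2) fun h => absurd h.2.symm hay
  have hxy := h.xy
  have hab := h.ab
  have hya' : a' ≠ y := fun e => hay ((ha y).2 (by simp [e]))
  have hbx' : x' ≠ b := fun e => hbx ((hx b).2 (by simp [e])).symm
  obtain rfl : a' = b' := by simpa [haz, hya'] using (hb a').1 hba'
  obtain rfl : x' = y' := by simpa [hxz, hbx'] using (hy x').1 hyx'
  have hpr : G.Adj a' x' := by
    have ha' : ∀ w, G.Adj a w ↔ w = x ∨ w = z ∨ w = a' := fun w => by rw [ha]; tauto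
    have hx' : ∀ w, G.Adj x w ↔ w = a ∨ w = z' ∨ w = x' := fun w => by rw [hx]; tauto
    rcases hS ha' hx' with h₁ | h₁
    · exact h₁.2
    · have := (hz x').1 h₁.1
      have := (hx x').2 (by simp)
      grind [SimpleGraph.adj_comm]
  have hap := (ha a').2 (by simp)
  have hxr := (hx x').2 (by simp)
  have hp : ∀ w, G.Adj a' w → w = a ∨ w = b ∨ w = x' := fun w hw => by
    have := hG.subcubic a' a b x' w hap.symm hba'.symm hpr hw
    grind
  have hr : ∀ w, G.Adj x' w → w = x ∨ w = y ∨ w = a' := fun w hw => by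
    have := hG.subcubic x' x y a' w hxr.symm hyx'.symm hpr.symm hw
    grind
  have hzx' : z ≠ x' := fun e => by
    rcases (hz x).1 (e ▸ hxr.symm) with h₁ | h₁ | h₁
    exacts [hzx.ne h₁.symm, hax.ne h₁.symm, h.bx h₁.symm]
  have hz'a' : z' ≠ a' := fun e => by
    rcases (hz' a).1 (e ▸ hap.symm) with h₁ | h₁ | h₁
    exacts [hza.ne h₁.symm, hax.ne h₁, h.ay h₁]
  -- the remaining case is the three-dimensional cube
  refine hG.no_bipartite_component hza hxr hyx' hpr hzx hax hby ?_ ?_ ?_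
  · simp only [not_or]
    rintro v (rfl | rfl | rfl | rfl)
    · exact ⟨((hz z').2 (by simp)).ne, hza.ne, hzb.ne, hzx'⟩
    · exact ⟨hzx.ne.symm, hax.ne.symm, h.bx.symm, hxr.ne⟩
    · exact ⟨hzy.ne.symm, h.ay.symm, hby.ne.symm, hyx'.ne⟩
    · exact ⟨hz'a'.symm, hap.ne.symm, hba'.ne.symm, hpr.ne⟩
  · rintro v (rfl | rfl | rfl | rfl) w hw
    · rcases (hz w).1 hw with e | e | e <;> simp [e]
    · rcases (hx w).1 hw with e | e | e <;> simp [e]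
    · rcases (hy w).1 hw with e | e | e <;> simp [e]
    · rcases hp w hw with e | e | e <;> simp [e]
  · rintro v (rfl | rfl | rfl | rfl) w hw
    · rcases (hz' w).1 hw with e | e | e <;> simp [e]
    · rcases (ha w).1 hw with e | e | e <;> simp [e]
    · rcases (hb w).1 hw with e | e | e <;> simp [e]
    · rcases hr w hw with e | e | e <;> simp [e]

theorem exists_good [Finite V] (G : SimpleGraph V)
    (hsub : ∀ z a b d e, G.Adj z a → G.Adj z b → G.Adj z d → G.Adj z e →
      a = b ∨ a = d ∨ a = e ∨ b = d ∨ b = e ∨ d = e)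
    (hK4 : ∀ a b d e, G.Adj a b → G.Adj a d → G.Adj a e → G.Adj b d → G.Adj b e → ¬ G.Adj d e)
    (hT : ∀ p q r, ¬ IsTriangleComponent G p q r) : ∃ c, Good G c := by
  induction G using WellFoundedLT.induction with
  | ind G ih =>
    by_contra hn
    push Not at hn
    refine not_minimalBad ⟨hsub, hK4, hT, hn, fun H hH => ih H hH ?_ ?_⟩
    · exact fun z a b d e h₁ h₂ h₃ h₄ => hsub z a b d e (hH.le h₁) (hH.le h₂) (hH.le h₃) (hH.le h₄)
    · exact fun a b d e h₁ h₂ h₃ h₄ h₅ h₆ => hK4 a b d e (hH.le h₁) (hH.le h₂) (hH.le h₃)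
        (hH.le h₄) (hH.le h₅) (hH.le h₆)

theorem mem_of_connected (hconn : G.Connected) {a : V} (ha : a ∈ U)
    (hU : ∀ u ∈ U, ∀ w, G.Adj u w → w ∈ U) (v : V) : v ∈ U := by
  obtain ⟨p⟩ := hconn.preconnected a v
  induction p with
  | nil => exact ha
  | cons h _ ih => exact ih (hU _ ha _ h)

theorem nonempty_iso_completeGraph [Fintype V] {n : ℕ} (hn : Fintype.card V = n)
    (h : ∀ u v, u ≠ v → G.Adj u v) : Nonempty (G ≃g completeGraph (Fin n)) := by
  let e := Fintype.equivFinOfCardEq hn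
  exact ⟨⟨e, fun {u v} => ⟨fun h' => h u v fun h'' => h'.ne (congrArg e h''),
    fun h' h'' => h'.ne (e.injective h'')⟩⟩⟩

theorem card_eq_ncard [Fintype V] (hU : ∀ v, v ∈ U) : Fintype.card V = U.ncard := by
  rw [Set.eq_univ_of_forall hU, Set.ncard_univ, Nat.card_eq_fintype_card]

theorem Good.isLDSet (hc : Good G c) (hot : ¬ ∃ u v : V, OpenTwins G u v)
    (hiso : ∀ v, ∃ w, G.Adj v w) (k : Bool) : IsLDSet G {v | c v = k} := by
  refine ⟨fun v => ?_, fun u hu v hv huv h => hot ⟨u, v, huv, ?_⟩⟩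
  · by_cases hv : c v = k
    · exact ⟨v, Set.mem_insert _ _, hv⟩
    · obtain ⟨w, hw⟩ := hiso v
      obtain ⟨w, hw, hwc⟩ := hc.dom v w hw
      refine ⟨w, Set.mem_insert_of_mem _ hw, ?_⟩
      change c w = k
      rw [Bool.eq_not.2 hwc, Bool.eq_not.2 hv, Bool.not_not]
  · have hu' : c u = !k := Bool.eq_not.2 hu
    have hv' : c v = !k := Bool.eq_not.2 hv
    ext w
    refine hc.sep u v (hu'.trans hv'.symm) (fun w hw => ?_) w
    have hwk : c w = k := by rw [Bool.eq_not.2 hw, hu']; simp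
    have := Set.ext_iff.1 h w
    simp only [closedNbhd, Set.mem_inter_iff, Set.mem_insert_iff, mem_neighborSet,
      Set.mem_ofPred_eq, hwk, and_true] at this
    have hwu : w ≠ u := fun e => hu (e ▸ hwk)
    have hwv : w ≠ v := fun e => hv (e ▸ hwk)
    simpa [hwu, hwv] using this

theorem Good.two_mul_ldNum_le [Fintype V] (hc : Good G c) (hot : ¬ ∃ u v : V, OpenTwins G u v)
    (hiso : ∀ v, ∃ w, G.Adj v w) : 2 * ldNum G ≤ Fintype.card V := by
  have h : ∀ k, ldNum G ≤ {v | c v = k}.ncard := fun k =>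
    Nat.sInf_le ⟨_, hc.isLDSet hot hiso k, rfl⟩
  have h₁ := Set.ncard_add_ncard_compl {v | c v = true}
  have h₂ : {v | c v = true}ᶜ = {v | c v = false} := by ext; simp
  rw [h₂, Nat.card_eq_fintype_card] at h₁
  have := h true
  have := h false
  omega

theorem eq_of_subcubic [Finite V] (hsub : Subcubic G) (z a b d e : V) (ha : G.Adj z a)
    (hb : G.Adj z b) (hd : G.Adj z d) (he : G.Adj z e) :
    a = b ∨ a = d ∨ a = e ∨ b = d ∨ b = e ∨ d = e := by
  by_contra hn
  push Not at hn
  obtain ⟨hab, had, hae, hbd, hbe, hde⟩ := hn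
  have h₁ : ({a, b, d, e} : Set V).ncard ≤ deg G z := Set.ncard_le_ncard (by
    rintro w (rfl | rfl | rfl | rfl) <;> assumption) (Set.toFinite _)
  have h₂ : ({a, b, d, e} : Set V).ncard = 4 := by
    rw [Set.ncard_insert_of_notMem (by simp [hab, had, hae]),
      Set.ncard_insert_of_notMem (by simp [hbd, hbe]), Set.ncard_pair hde]
  have := hsub z
  omega

end LocatingColouring

open LocatingColouring

/-- Every connected subcubic graph with no open twins, no isolated
vertices, not isomorphic to `K_3` or `K_4`, satisfies `γ^LD(G) ≤ n/2`. -/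
theorem stmt1 {V : Type*} [Fintype V] (G : SimpleGraph V)
    (hconn : G.Connected) (hsub : Subcubic G)
    (hot : ¬ ∃ u v : V, OpenTwins G u v)
    (hiso : ∀ v : V, deg G v ≠ 0)
    (hK3 : ¬ Nonempty (G ≃g completeGraph (Fin 3)))
    (hK4 : ¬ Nonempty (G ≃g completeGraph (Fin 4))) :
    2 * ldNum G ≤ Fintype.card V := by
  have hcub := eq_of_subcubic hsub
  obtain ⟨c, hc⟩ : ∃ c, Good G c := by
    refine exists_good G hcub (fun a b d e hab had hae hbd hbe hde => hK4 ?_)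
      (fun p q r h => hK3 ?_)
    · have hV := mem_of_connected (U := {a, b, d, e}) hconn (a := a) (by simp) (by
        have key : ∀ {u x y z w : V}, G.Adj u x → G.Adj u y → G.Adj u z → x ≠ y → x ≠ z → y ≠ z →
            G.Adj u w → w = x ∨ w = y ∨ w = z := fun hx hy hz h₁ h₂ h₃ hw => by
          have := hcub _ _ _ _ _ hx hy hz hw
          tauto
        simp only [Set.mem_insert_iff, Set.mem_singleton_iff]
        rintro u (rfl | rfl | rfl | rfl) w hw
        · have := key hab had hae hbd.ne hbe.ne hde.ne hw; tauto
        · have := key hab.symm hbd hbe had.ne hae.ne hde.ne hw; tauto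
        · have := key had.symm hbd.symm hde hab.ne hae.ne hbe.ne hw; tauto
        · have := key hae.symm hbe.symm hde.symm hab.ne had.ne hbd.ne hw; tauto)
      refine nonempty_iso_completeGraph ?_ fun u v huv => ?_
      · rw [card_eq_ncard hV, Set.ncard_insert_of_notMem (by simp [hab.ne, had.ne, hae.ne]),
          Set.ncard_insert_of_notMem (by simp [hbd.ne, hbe.ne]), Set.ncard_pair hde.ne]
      · rcases hV u with rfl | rfl | rfl | rfl <;> rcases hV v with rfl | rfl | rfl | rfl <;>
          first | exact absurd rfl huv | assumption | (apply SimpleGraph.Adj.symm; assumption)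
    · have hV := mem_of_connected (U := {p, q, r}) hconn (a := p) (by simp) (by
        simp only [Set.mem_insert_iff, Set.mem_singleton_iff]
        rintro u (rfl | rfl | rfl) w hw
        · have := h.left w hw; tauto
        · have := h.mid w hw; tauto
        · have := h.right w hw; tauto)
      have hpq := h.pq
      have hqr := h.qr
      have hpr := h.pr
      refine nonempty_iso_completeGraph ?_ fun u v huv => ?_
      · rw [card_eq_ncard hV, Set.ncard_insert_of_notMem (by simp [hpq.ne, hpr.ne]),
          Set.ncard_pair hqr.ne]
      · rcases hV u with rfl | rfl | rfl <;> rcases hV v with rfl | rfl | rfl <;>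
          first | exact absurd rfl huv | assumption | (apply SimpleGraph.Adj.symm; assumption)
  refine hc.two_mul_ldNum_le hot fun v => ?_
  by_contra hn
  push Not at hn
  exact hiso v (by rw [deg, show G.neighborSet v = ∅ by ext; simp [hn], Set.ncard_empty])
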